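/- arXiv:1202.3082 — 8 statements merged into one kernel-verified Lean document; each statement's English description precedes it below -/
import Mathlib

section
/- Let G be a 4-regular simple graph on 8 vertices (such a graph is necessarily connected). Then every spanning tree of G has at most 5 leaves if and only if every edge of G belongs to a triangle (equivalently, the neighborhoods of any two adjacent vertices of G have nonempty intersection). -/
open scoped Classical

/-- The number of leaves (vertices of degree 1) of a graph `T` (intended: a tree). -/
noncomputable def leafCount {V : Type*} [Fintype V] (T : SimpleGraph V) : ℕ :=
  Fintype.card {v : V // T.degree v = 1}

namespace SimpleGraph

variable {V : Type*}

theorem Connected.forall_of_adj_closed {T : SimpleGraph V} (hT : T.Connected) {P : V → Prop}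
    (hP : ∀ a b, T.Adj a b → P a → P b) {x : V} (hx : P x) (y : V) : P y := by
  obtain ⟨p⟩ := hT.preconnected x y
  induction p with
  | nil => exact hx
  | cons h _ ih => exact ih (hP _ _ h hx)

variable [Fintype V]

theorem eq_of_adj_of_degree_eq_one {T : SimpleGraph V} {a b c : V} (h : T.degree a = 1)
    (hb : T.Adj a b) (hc : T.Adj a c) : b = c :=
  (T.degree_eq_one_iff_existsUnique_adj.mp h).unique hb hc

/-- In a connected graph with no dominating vertex, every vertex has a neighbor of
degree different from one. -/
theorem Connected.exists_adj_degree_ne_one {T : SimpleGraph V} (hT : T.Connected)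
    (hdeg : ∀ v, T.degree v + 1 < Fintype.card V) (u : V) :
    ∃ v, T.Adj u v ∧ T.degree v ≠ 1 := by
  by_contra! h
  have hall : ∀ y, y = u ∨ T.Adj u y := by
    refine hT.forall_of_adj_closed ?_ (x := u) (Or.inl rfl)
    rintro a b hab (rfl | ha)
    · exact Or.inr hab
    · exact Or.inl (eq_of_adj_of_degree_eq_one (h a ha) hab ha.symm)
  have hsub : (Finset.univ : Finset V) ⊆ insert u (T.neighborFinset u) := fun y _ => by
    simpa using hall y
  have hcard := (Finset.card_le_card hsub).trans (Finset.card_insert_le _ _)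
  rw [Finset.card_univ, card_neighborFinset_eq_degree] at hcard
  exact absurd (hdeg u) (by omega)

/-- If two adjacent vertices are the only ones that may have degree different from one, then
every vertex of the connected graph is adjacent to one of them. -/
theorem Connected.adj_or_adj_of_degree_eq_one {T : SimpleGraph V} (hT : T.Connected) {u v : V}
    (huv : T.Adj u v) (h : ∀ w, w ≠ u → w ≠ v → T.degree w = 1) (y : V) :
    T.Adj u y ∨ T.Adj v y := by
  revert y
  refine hT.forall_of_adj_closed ?_ (x := v) (Or.inl huv)
  intro a b hab ha
  by_cases hau : a = u
  · exact Or.inl (hau ▸ hab)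
  by_cases hav : a = v
  · exact Or.inr (hav ▸ hab)
  have hd := h a hau hav
  rcases ha with ha | ha
  · exact Or.inr (eq_of_adj_of_degree_eq_one hd ha.symm hab ▸ huv.symm)
  · exact Or.inl (eq_of_adj_of_degree_eq_one hd ha.symm hab ▸ huv)

/-- Two neighborhoods whose sizes add up to the number of vertices cover the vertex set iff they
are disjoint. -/
theorem forall_adj_or_adj_iff_not_exists_common {G : SimpleGraph V} {u v : V}
    (h : G.degree u + G.degree v = Fintype.card V) :
    (∀ y, G.Adj u y ∨ G.Adj v y) ↔ ¬ ∃ w, G.Adj u w ∧ G.Adj v w := by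
  have hsum := Finset.card_union_add_card_inter (G.neighborFinset u) (G.neighborFinset v)
  rw [card_neighborFinset_eq_degree, card_neighborFinset_eq_degree, h] at hsum
  have hcover : (∀ y, G.Adj u y ∨ G.Adj v y) ↔
      (G.neighborFinset u ∪ G.neighborFinset v).card = Fintype.card V := by
    rw [Finset.card_eq_iff_eq_univ, Finset.eq_univ_iff_forall]
    simp
  have hdisj : (¬ ∃ w, G.Adj u w ∧ G.Adj v w) ↔
      (G.neighborFinset u ∩ G.neighborFinset v).card = 0 := by
    rw [Finset.card_eq_zero, Finset.eq_empty_iff_forall_notMem]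
    simp
  rw [hcover, hdisj]
  omega

/-- An edge whose end-neighborhoods partition the vertex set yields a spanning tree in which all
other vertices are leaves. -/
theorem exists_isTree_degree_eq_one {G : SimpleGraph V} {u v : V} (huv : G.Adj u v)
    (hcover : ∀ y, G.Adj u y ∨ G.Adj v y) (hdisj : ¬ ∃ w, G.Adj u w ∧ G.Adj v w) :
    ∃ T ≤ G, T.IsTree ∧ ∀ w, w ≠ u → w ≠ v → T.degree w = 1 := by
  let D : SimpleGraph V :=
    { Adj := fun a b => G.Adj a b ∧ (a = u ∨ a = v ∨ b = u ∨ b = v)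
      symm := ⟨fun a b h => ⟨h.1.symm, by tauto⟩⟩
      loopless := ⟨fun a h => G.loopless.irrefl a h.1⟩ }
  have hD : D.Connected := by
    have hreach : ∀ y, D.Reachable u y := fun y => by
      have huv' : D.Adj u v := ⟨huv, by simp⟩
      rcases hcover y with h | h
      · exact Adj.reachable (G := D) ⟨h, by simp⟩
      · exact huv'.reachable.trans (Adj.reachable (G := D) ⟨h, by simp⟩)
    exact (connected_iff _).mpr ⟨fun a b => (hreach a).symm.trans (hreach b), ⟨u⟩⟩
  obtain ⟨T, hTD, hT⟩ := hD.exists_isTree_le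
  refine ⟨T, fun a b h => (hTD h).1, hT, fun w hwu hwv => ?_⟩
  have : Nontrivial V := ⟨u, v, huv.ne⟩
  obtain ⟨b, hb⟩ := hT.connected.preconnected.exists_adj_of_nontrivial w
  refine T.degree_eq_one_iff_existsUnique_adj.mpr ⟨b, hb, fun c hc => ?_⟩
  have h1 := hTD hb
  have h2 := hTD hc
  have hb' : b = u ∨ b = v := by have := h1.2; tauto
  have hc' : c = u ∨ c = v := by have := h2.2; tauto
  have h3 := h1.1.symm
  have h4 := h2.1.symm
  rcases hb' with rfl | rfl <;> rcases hc' with rfl | rfl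
  · rfl
  · exact absurd ⟨w, h3, h4⟩ hdisj
  · exact absurd ⟨w, h4, h3⟩ hdisj
  · rfl

end SimpleGraph

theorem leafCount_add_card_degree_ne_one {V : Type*} [Fintype V] (T : SimpleGraph V) :
    leafCount T + (Finset.univ.filter fun v => T.degree v ≠ 1).card = Fintype.card V := by
  rw [leafCount, Fintype.card_subtype, Finset.card_filter_add_card_filter_not, Finset.card_univ]

/-- For a 4-regular graph on 8 vertices, every spanning tree has at most 5 leaves
iff every edge belongs to a triangle (the neighborhoods of any two adjacent vertices
intersect). -/
theorem fourRegular_eight_maxLeaves_le_five_iff_every_edge_in_triangle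
    {V : Type*} [Fintype V] (G : SimpleGraph V)
    (hV : Fintype.card V = 8) (hreg : ∀ v, G.degree v = 4) :
    (∀ T ≤ G, T.IsTree → leafCount T ≤ 5) ↔
      (∀ u v, G.Adj u v → ∃ w, G.Adj u w ∧ G.Adj v w) := by
  have hpart (u v : V) := G.forall_adj_or_adj_iff_not_exists_common (u := u) (v := v)
    (by rw [hreg, hreg, hV])
  constructor
  · intro h u v huv
    by_contra hdisj
    obtain ⟨T, hTG, hT, hleaf⟩ :=
      SimpleGraph.exists_isTree_degree_eq_one huv ((hpart u v).mpr hdisj) hdisj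
    have hsub : (Finset.univ.filter fun w => T.degree w ≠ 1) ⊆ {u, v} := fun w hw => by
      by_contra hw'
      simp only [Finset.mem_insert, Finset.mem_singleton, not_or] at hw'
      exact (Finset.mem_filter.mp hw).2 (hleaf w hw'.1 hw'.2)
    have hcard := (Finset.card_le_card hsub).trans Finset.card_le_two
    have := leafCount_add_card_degree_ne_one T
    have := h T hTG hT
    omega
  · intro h T hTG hT
    by_contra! hlc
    have hcon := hT.connected
    have hdeg : ∀ v, T.degree v + 1 < Fintype.card V := fun v => by
      have := SimpleGraph.degree_le_of_le hTG (v := v)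
      have := hreg v
      omega
    obtain ⟨x⟩ := hcon.nonempty
    obtain ⟨u, -, hu⟩ := hcon.exists_adj_degree_ne_one hdeg x
    obtain ⟨v, huv, hv⟩ := hcon.exists_adj_degree_ne_one hdeg u
    have hleaf : ∀ w, w ≠ u → w ≠ v → T.degree w = 1 := fun w hwu hwv => by
      by_contra hw
      have hsub : ({w, u, v} : Finset V) ⊆ Finset.univ.filter fun w => T.degree w ≠ 1 := by
        intro a ha
        simp only [Finset.mem_insert, Finset.mem_singleton] at ha
        rcases ha with rfl | rfl | rfl <;> simpa
      have hcard := Finset.card_le_card hsub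
      rw [Finset.card_eq_three.mpr ⟨w, u, v, hwu, hwv, huv.ne, rfl⟩] at hcard
      have := leafCount_add_card_degree_ne_one T
      omega
    refine (hpart u v).mp (fun y => ?_) (h u v (hTG huv))
    exact (hcon.adj_or_adj_of_degree_eq_one huv hleaf y).imp (fun h => hTG h) (fun h => hTG h)
end

section
/- Let G be a 4-regular simple graph on 8 vertices such that every edge of G belongs to a triangle. Then G is isomorphic to C_8^2 or G is isomorphic to G_8. In other words, up to isomorphism there are exactly two 4-regular graphs on 8 vertices in which every edge lies in a triangle. -/
open scoped Classical

/-- `C_k²`, the square of the `k`-cycle: vertices `ZMod k`, with `i ~ j` iff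
`i - j ≡ ±1` or `±2 (mod k)`. -/
def cycleSq (k : ℕ) : SimpleGraph (ZMod k) :=
  SimpleGraph.fromRel (fun i j => i - j = 1 ∨ i - j = 2)

/-- The graph `G₈` on 8 vertices `a₁ a₂ b₁ b₂ b₃ r₁ r₂ r₃`
(encoded as `0 1 2 3 4 5 6 7`) with edges `a₁a₂`; `aᵢrⱼ` for all `i, j`;
`bᵢbⱼ` for all `i ≠ j`; and `bᵢrⱼ` for all `i ≠ j`. -/
def G8 : SimpleGraph (Fin 8) :=
  SimpleGraph.fromRel (fun u v =>
    (u, v) ∈ [((0 : Fin 8), (1 : Fin 8)), (0, 5), (0, 6), (0, 7), (1, 5), (1, 6), (1, 7),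
      (2, 3), (2, 4), (3, 4), (2, 6), (2, 7), (3, 5), (3, 7), (4, 5), (4, 6)])

open SimpleGraph in
/-- A bijective homomorphism that does not increase degrees is an isomorphism. -/
theorem nonempty_iso_of_bijective_hom {V W : Type*} [Fintype V] [Fintype W]
    {H : SimpleGraph W} {G : SimpleGraph V} (f : H →g G) (hf : Function.Bijective f)
    (hdeg : ∀ w, G.degree (f w) ≤ H.degree w) : Nonempty (G ≃g H) := by
  refine ⟨RelIso.symm ⟨Equiv.ofBijective f hf, ?_⟩⟩
  intro u w
  refine ⟨fun h => ?_, fun h => f.map_adj h⟩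
  have hsub : (H.neighborFinset u).image f ⊆ G.neighborFinset (f u) := by
    intro x hx
    obtain ⟨y, hy, rfl⟩ := Finset.mem_image.1 hx
    exact (mem_neighborFinset ..).2 (f.map_adj ((mem_neighborFinset ..).1 hy))
  have heq := Finset.eq_of_subset_of_card_le hsub (by
    rw [Finset.card_image_of_injective _ hf.1, card_neighborFinset_eq_degree,
      card_neighborFinset_eq_degree]
    exact hdeg u)
  have hw : f w ∈ (H.neighborFinset u).image f :=
    heq ▸ (mem_neighborFinset ..).2 h
  obtain ⟨y, hy, hyw⟩ := Finset.mem_image.1 hw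
  exact hf.1 hyw ▸ (mem_neighborFinset ..).1 hy

theorem cycleSq_eight_adj (i j : Fin 8) : (cycleSq 8).Adj i j ↔
    (j - i = 1 ∨ j - i = 2 ∨ i - j = 1 ∨ i - j = 2) := by
  change (i ≠ j ∧ ((i - j = 1 ∨ i - j = 2) ∨ (j - i = 1 ∨ j - i = 2))) ↔ _
  revert i j
  decide

theorem degree_eq_card_filter {n : ℕ} (H : SimpleGraph (Fin n)) (p : Fin n → Fin n → Prop)
    [∀ i, DecidablePred (p i)] (hp : ∀ i j, H.Adj i j ↔ p i j) (i : Fin n) :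
    H.degree i = (Finset.univ.filter (p i)).card := by
  rw [← SimpleGraph.card_neighborFinset_eq_degree]
  congr 1
  ext j
  simp [hp]

theorem cycleSq_eight_degree (i : Fin 8) : SimpleGraph.degree (V := Fin 8) (cycleSq 8) i = 4 := by
  refine (degree_eq_card_filter (n := 8) (cycleSq 8) _ cycleSq_eight_adj i).trans ?_
  revert i
  decide

theorem G8_adj (i j : Fin 8) : G8.Adj i j ↔ i ≠ j ∧
    ((i, j) ∈ [((0 : Fin 8), (1 : Fin 8)), (0, 5), (0, 6), (0, 7), (1, 5), (1, 6), (1, 7),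
      (2, 3), (2, 4), (3, 4), (2, 6), (2, 7), (3, 5), (3, 7), (4, 5), (4, 6)] ∨
    (j, i) ∈ [((0 : Fin 8), (1 : Fin 8)), (0, 5), (0, 6), (0, 7), (1, 5), (1, 6), (1, 7),
      (2, 3), (2, 4), (3, 4), (2, 6), (2, 7), (3, 5), (3, 7), (4, 5), (4, 6)]) :=
  Iff.rfl

theorem G8_degree (i : Fin 8) : G8.degree i = 4 := by
  rw [degree_eq_card_filter G8 _ G8_adj]
  revert i
  decide

/-- The relation `A` on `Fin 8` contains a copy of `C₈²` starting at `0`. -/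
def ContainsCycleSq (A : Fin 8 → Fin 8 → Bool) : Prop :=
  ∃ x₁, A 0 x₁ ∧ ∃ x₂, (A 0 x₂ ∧ A x₁ x₂) ∧
  ∃ x₃, (x₃ ≠ 0 ∧ A x₁ x₃ ∧ A x₂ x₃) ∧
  ∃ x₄, (x₄ ≠ 0 ∧ x₄ ≠ x₁ ∧ A x₂ x₄ ∧ A x₃ x₄) ∧
  ∃ x₅, (x₅ ≠ 0 ∧ x₅ ≠ x₁ ∧ x₅ ≠ x₂ ∧ A x₃ x₅ ∧ A x₄ x₅) ∧
  ∃ x₆, (A x₄ x₆ ∧ A x₅ x₆ ∧ A x₆ 0) ∧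
  ∃ x₇, (A x₅ x₇ ∧ A x₆ x₇ ∧ A x₇ 0 ∧ A x₇ x₁) ∧ [0, x₁, x₂, x₃, x₄, x₅, x₆, x₇].Nodup

/-- The relation `A` on `Fin 8` contains a copy of `G₈`. -/
def ContainsG8 (A : Fin 8 → Fin 8 → Bool) : Prop :=
  ∃ a₁ a₂, A a₁ a₂ ∧ ∃ r₁, (A a₁ r₁ ∧ A a₂ r₁) ∧
  ∃ r₂, (r₁ ≠ r₂ ∧ A a₁ r₂ ∧ A a₂ r₂) ∧
  ∃ r₃, (r₁ ≠ r₃ ∧ r₂ ≠ r₃ ∧ A a₁ r₃ ∧ A a₂ r₃) ∧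
  ∃ b₁, (A b₁ r₂ ∧ A b₁ r₃ ∧ b₁ ≠ a₁ ∧ b₁ ≠ a₂) ∧
  ∃ b₂, (A b₁ b₂ ∧ A b₂ r₁ ∧ A b₂ r₃) ∧
  ∃ b₃, (A b₁ b₃ ∧ A b₂ b₃ ∧ A b₃ r₁ ∧ A b₃ r₂) ∧ [a₁, a₂, b₁, b₂, b₃, r₁, r₂, r₃].Nodup

set_option synthInstance.maxHeartbeats 0 in
set_option synthInstance.maxSize 100000 in
instance (A : Fin 8 → Fin 8 → Bool) : Decidable (ContainsCycleSq A) := by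
  unfold ContainsCycleSq; infer_instance

set_option synthInstance.maxHeartbeats 0 in
set_option synthInstance.maxSize 100000 in
instance (A : Fin 8 → Fin 8 → Bool) : Decidable (ContainsG8 A) := by
  unfold ContainsG8; infer_instance

/-- The symmetric irreflexive relation on `Fin 8` in which `0` is related to exactly
`1, 2, 3, 4`, `1` is related to `2`, and the remaining pairs `i < j` are given by `bᵢⱼ`. -/
def adjTable (b₁₃ b₁₄ b₁₅ b₁₆ b₁₇ b₂₃ b₂₄ b₂₅ b₂₆ b₂₇ b₃₄ b₃₅ b₃₆ b₃₇ b₄₅ b₄₆ b₄₇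
    b₅₆ b₅₇ b₆₇ : Bool) : Fin 8 → Fin 8 → Bool :=
  fun i j => ([
    [false, true, true, true, true, false, false, false],
    [true, false, true, b₁₃, b₁₄, b₁₅, b₁₆, b₁₇],
    [true, true, false, b₂₃, b₂₄, b₂₅, b₂₆, b₂₇],
    [true, b₁₃, b₂₃, false, b₃₄, b₃₅, b₃₆, b₃₇],
    [true, b₁₄, b₂₄, b₃₄, false, b₄₅, b₄₆, b₄₇],
    [false, b₁₅, b₂₅, b₃₅, b₄₅, false, b₅₆, b₅₇],
    [false, b₁₆, b₂₆, b₃₆, b₄₆, b₅₆, false, b₆₇],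
    [false, b₁₇, b₂₇, b₃₇, b₄₇, b₅₇, b₆₇, false]].getD i []).getD j false

set_option synthInstance.maxHeartbeats 0 in
set_option synthInstance.maxSize 100000 in
set_option maxHeartbeats 0 in
set_option maxRecDepth 100000 in
theorem contains_of_adjTable : ∀ b₁₃ b₁₄ b₁₅ b₁₆ b₁₇ : Bool,
    2 + (b₁₃.toNat + (b₁₄.toNat + (b₁₅.toNat + (b₁₆.toNat + b₁₇.toNat)))) = 4 →
    ∀ b₂₃ b₂₄ b₂₅ b₂₆ b₂₇ : Bool,
    2 + (b₂₃.toNat + (b₂₄.toNat + (b₂₅.toNat + (b₂₆.toNat + b₂₇.toNat)))) = 4 →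
    ∀ b₃₄ b₃₅ b₃₆ b₃₇ : Bool, (b₁₃ || b₂₃ || b₃₄) →
    1 + (b₁₃.toNat + (b₂₃.toNat + (b₃₄.toNat + (b₃₅.toNat + (b₃₆.toNat + b₃₇.toNat))))) = 4 →
    (b₁₄ || b₂₄ || b₃₄) → ∀ b₄₅ b₄₆ b₄₇ : Bool,
    1 + (b₁₄.toNat + (b₂₄.toNat + (b₃₄.toNat + (b₄₅.toNat + (b₄₆.toNat + b₄₇.toNat))))) = 4 →
    ∀ b₅₆ b₅₇ : Bool,
    b₁₅.toNat + (b₂₅.toNat + (b₃₅.toNat + (b₄₅.toNat + (b₅₆.toNat + b₅₇.toNat)))) = 4 →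
    ∀ b₆₇ : Bool,
    b₁₆.toNat + (b₂₆.toNat + (b₃₆.toNat + (b₄₆.toNat + (b₅₆.toNat + b₆₇.toNat)))) = 4 →
    b₁₇.toNat + (b₂₇.toNat + (b₃₇.toNat + (b₄₇.toNat + (b₅₇.toNat + b₆₇.toNat)))) = 4 →
    let A := adjTable b₁₃ b₁₄ b₁₅ b₁₆ b₁₇ b₂₃ b₂₄ b₂₅ b₂₆ b₂₇ b₃₄ b₃₅ b₃₆ b₃₇ b₄₅ b₄₆ b₄₇
      b₅₆ b₅₇ b₆₇
    (∀ i j, i < j → A i j → ∃ k, A i k ∧ A j k) → ContainsCycleSq A ∨ ContainsG8 A := by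
  decide +kernel

/-- The vertices can be labelled so that `0` has neighbours `1, 2, 3, 4` and `1` is adjacent
to `2`. -/
theorem exists_labelling {V : Type*} [Fintype V] (G : SimpleGraph V)
    (hV : Fintype.card V = 8) (hreg : ∀ v, G.degree v = 4)
    (htri : ∀ u v, G.Adj u v → ∃ w, G.Adj u w ∧ G.Adj v w) :
    ∃ e : Fin 8 ≃ V, G.Adj (e 1) (e 2) ∧ ∀ j, decide (G.Adj (e 0) (e j)) =
      ![false, true, true, true, true, false, false, false] j := by
  obtain ⟨v⟩ : Nonempty V := Fintype.card_pos_iff.1 (by omega)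
  have hN : (G.neighborFinset v).card = 4 := (G.card_neighborFinset_eq_degree v).trans (hreg v)
  obtain ⟨a, ha⟩ : (G.neighborFinset v).Nonempty := Finset.card_pos.1 (by omega)
  obtain ⟨b, hb, hab⟩ := htri v a ((G.mem_neighborFinset v a).1 ha)
  have hb' : b ∈ (G.neighborFinset v).erase a :=
    Finset.mem_erase.2 ⟨hab.ne', (G.mem_neighborFinset v b).2 hb⟩
  obtain ⟨c, d, -, hcd⟩ : ∃ c d, c ≠ d ∧ ((G.neighborFinset v).erase a).erase b = {c, d} :=
    Finset.card_eq_two.1 (by rw [Finset.card_erase_of_mem hb', Finset.card_erase_of_mem ha, hN])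
  have hR : (insert v (G.neighborFinset v))ᶜ.card = 3 := by
    rw [Finset.card_compl, Finset.card_insert_of_notMem (by simp), hN, hV]
  obtain ⟨p, q, r, -, -, -, hpqr⟩ := Finset.card_eq_three.1 hR
  have hadj (x : V) : G.Adj v x ↔ x = a ∨ x = b ∨ x = c ∨ x = d := by
    rw [← SimpleGraph.mem_neighborFinset, ← Finset.insert_erase ha, ← Finset.insert_erase hb', hcd]
    simp
  have hnon (x : V) : ¬ (x = v ∨ G.Adj v x) ↔ x = p ∨ x = q ∨ x = r := by
    simpa using Finset.ext_iff.1 hpqr x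
  have hsurj : Function.Surjective ![v, a, b, c, d, p, q, r] := by
    intro x
    by_cases h : x = v ∨ G.Adj v x
    · rcases h with rfl | h
      · exact ⟨0, rfl⟩
      · rcases (hadj x).1 h with rfl | rfl | rfl | rfl
        exacts [⟨1, rfl⟩, ⟨2, rfl⟩, ⟨3, rfl⟩, ⟨4, rfl⟩]
    · rcases (hnon x).1 h with rfl | rfl | rfl
      exacts [⟨5, rfl⟩, ⟨6, rfl⟩, ⟨7, rfl⟩]
  refine ⟨Equiv.ofBijective _
    ((Fintype.bijective_iff_surjective_and_card _).2 ⟨hsurj, by simp [hV]⟩), hab, ?_⟩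
  have hp : ¬ G.Adj v p := fun h => (hnon p).2 (by simp) (.inr h)
  have hq : ¬ G.Adj v q := fun h => (hnon q).2 (by simp) (.inr h)
  have hr : ¬ G.Adj v r := fun h => (hnon r).2 (by simp) (.inr h)
  have hadj' : G.Adj v a ∧ G.Adj v b ∧ G.Adj v c ∧ G.Adj v d := by simp [hadj]
  intro j
  fin_cases j <;> simp [hp, hq, hr, hadj']

theorem injective_of_nodup {α : Type*} {a b c d e f g h : α}
    (hn : [a, b, c, d, e, f, g, h].Nodup) : Function.Injective ![a, b, c, d, e, f, g, h] :=
  List.nodup_ofFn.1 (by simpa [List.ofFn_succ] using hn)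

theorem ContainsCycleSq.exists_hom {A : Fin 8 → Fin 8 → Bool} (hA : ∀ i j, A i j = A j i)
    (h : ContainsCycleSq A) : ∃ σ : Fin 8 → Fin 8, Function.Injective σ ∧
      ∀ i j : Fin 8, (cycleSq 8).Adj i j → A (σ i) (σ j) := by
  obtain ⟨x₁, _, x₂, _, x₃, _, x₄, _, x₅, _, x₆, _, x₇, _, hn⟩ := h
  refine ⟨_, injective_of_nodup hn, fun i j hij => ?_⟩
  have key : ∀ i j : Fin 8, j - i = 1 ∨ j - i = 2 →
      A (![0, x₁, x₂, x₃, x₄, x₅, x₆, x₇] i) (![0, x₁, x₂, x₃, x₄, x₅, x₆, x₇] j) := by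
    intro i j hij
    fin_cases i <;> rcases hij with h | h <;> obtain rfl := sub_eq_iff_eq_add.1 h <;> tauto
  rcases (cycleSq_eight_adj i j).1 hij with h | h | h | h
  · exact key i j (.inl h)
  · exact key i j (.inr h)
  · exact hA _ _ ▸ key j i (.inl h)
  · exact hA _ _ ▸ key j i (.inr h)

theorem ContainsG8.exists_hom {A : Fin 8 → Fin 8 → Bool} (hA : ∀ i j, A i j = A j i)
    (h : ContainsG8 A) : ∃ σ : Fin 8 → Fin 8, Function.Injective σ ∧
      ∀ i j, G8.Adj i j → A (σ i) (σ j) := by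
  obtain ⟨a₁, a₂, h₁, r₁, h₂, r₂, h₃, r₃, h₄, b₁, h₅, b₂, h₆, b₃, h₇, hn⟩ := h
  refine ⟨_, injective_of_nodup hn, fun i j hij => ?_⟩
  have key : ∀ e ∈ [((0 : Fin 8), (1 : Fin 8)), (0, 5), (0, 6), (0, 7), (1, 5), (1, 6), (1, 7),
      (2, 3), (2, 4), (3, 4), (2, 6), (2, 7), (3, 5), (3, 7), (4, 5), (4, 6)],
      A (![a₁, a₂, b₁, b₂, b₃, r₁, r₂, r₃] e.1) (![a₁, a₂, b₁, b₂, b₃, r₁, r₂, r₃] e.2) := by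
    simp [h₁, h₂, h₃, h₄, h₅, h₆, h₇]
  rcases ((G8_adj i j).1 hij).2 with h | h
  · exact key _ h
  · exact hA _ _ ▸ key _ h

theorem contains_of_regular (A : Fin 8 → Fin 8 → Bool) (hsymm : ∀ i j, A i j = A j i)
    (hirr : ∀ i, A i i = false)
    (hone : A 1 2 = true)
    (hzero : ∀ j, A 0 j = ![false, true, true, true, true, false, false, false] j)
    (hdeg : ∀ i, ∑ j, (A i j).toNat = 4) (htri : ∀ i j, A i j → ∃ k, A i k ∧ A j k) :
    ContainsCycleSq A ∨ ContainsG8 A := by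
  have hA : A = adjTable (A 1 3) (A 1 4) (A 1 5) (A 1 6) (A 1 7) (A 2 3) (A 2 4) (A 2 5)
      (A 2 6) (A 2 7) (A 3 4) (A 3 5) (A 3 6) (A 3 7) (A 4 5) (A 4 6) (A 4 7) (A 5 6) (A 5 7)
      (A 6 7) := by
    ext i j
    fin_cases i <;> fin_cases j <;>
      first
        | rfl
        | exact hirr _
        | exact hsymm _ _
        | exact hone
        | exact (hsymm _ _).trans hone
        | exact hzero _
        | exact (hsymm _ _).trans (hzero _)
  have hrow (i : Fin 8) : ∑ j, (adjTable (A 1 3) (A 1 4) (A 1 5) (A 1 6) (A 1 7) (A 2 3)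
      (A 2 4) (A 2 5) (A 2 6) (A 2 7) (A 3 4) (A 3 5) (A 3 6) (A 3 7) (A 4 5) (A 4 6) (A 4 7)
      (A 5 6) (A 5 7) (A 6 7) i j).toNat = 4 := hA ▸ hdeg i
  simp only [Fin.sum_univ_eight, adjTable] at hrow
  have h₁ := hrow 1
  have h₂ := hrow 2
  have h₃ := hrow 3
  have h₄ := hrow 4
  have h₅ := hrow 5
  have h₆ := hrow 6
  have h₇ := hrow 7
  simp at h₁ h₂ h₃ h₄ h₅ h₆ h₇
  have hlink (i : Fin 8) (h : A 0 i) : A i 1 ∨ A i 2 ∨ A i 3 ∨ A i 4 := by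
    obtain ⟨k, hk, hik⟩ := htri 0 i h
    rw [hzero] at hk
    fin_cases k <;>
      first
        | simp at hk; done
        | exact Or.inl hik
        | exact Or.inr (Or.inl hik)
        | exact Or.inr (Or.inr (Or.inl hik))
        | exact Or.inr (Or.inr (Or.inr hik))
  have hlink₃ : (A 1 3 || A 2 3 || A 3 4) = true := by
    simpa [hirr, hsymm 3 1, hsymm 3 2, or_assoc] using hlink 3 (hzero 3)
  have hlink₄ : (A 1 4 || A 2 4 || A 3 4) = true := by
    simpa [hirr, hsymm 4 1, hsymm 4 2, hsymm 4 3, or_assoc] using hlink 4 (hzero 4)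
  have h := contains_of_adjTable (A 1 3) (A 1 4) (A 1 5) (A 1 6) (A 1 7) (by omega)
    (A 2 3) (A 2 4) (A 2 5) (A 2 6) (A 2 7) (by omega) (A 3 4) (A 3 5) (A 3 6) (A 3 7) hlink₃
    (by omega) hlink₄ (A 4 5) (A 4 6) (A 4 7) (by omega) (A 5 6) (A 5 7) (by omega) (A 6 7)
    (by omega) (by omega)
  rw [← hA] at h
  exact h fun i j _ => htri i j

theorem nonempty_iso_of_labelling {V : Type*} [Fintype V] {G : SimpleGraph V}
    (hreg : ∀ v, G.degree v = 4) (e : Fin 8 ≃ V) {H : SimpleGraph (Fin 8)}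
    (hH : ∀ i, H.degree i = 4) (h : ∃ σ : Fin 8 → Fin 8, Function.Injective σ ∧
      ∀ i j, H.Adj i j → decide (G.Adj (e (σ i)) (e (σ j)))) : Nonempty (G ≃g H) := by
  obtain ⟨σ, hσ, hadj⟩ := h
  refine nonempty_iso_of_bijective_hom ⟨e ∘ σ, fun {i j} hij => of_decide_eq_true (hadj i j hij)⟩
    (e.bijective.comp (Finite.injective_iff_bijective.1 hσ)) fun i => ?_
  rw [hreg, hH]

/-- Every 4-regular graph on 8 vertices in which every edge belongs to a triangle
is isomorphic to `C₈²` or to `G₈`. -/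
theorem fourRegular_eight_every_edge_in_triangle_iso_cycleSq_eight_or_G8
    {V : Type*} [Fintype V] (G : SimpleGraph V)
    (hV : Fintype.card V = 8) (hreg : ∀ v, G.degree v = 4)
    (htri : ∀ u v, G.Adj u v → ∃ w, G.Adj u w ∧ G.Adj v w) :
    Nonempty (G ≃g cycleSq 8) ∨ Nonempty (G ≃g G8) := by
  obtain ⟨e, hone, he⟩ := exists_labelling G hV hreg htri
  have hsymm (i j : Fin 8) : decide (G.Adj (e i) (e j)) = decide (G.Adj (e j) (e i)) := by
    simp only [G.adj_comm]
  have hdeg (i : Fin 8) : ∑ j, (decide (G.Adj (e i) (e j))).toNat = 4 := by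
    rw [e.sum_comp (fun w => (decide (G.Adj (e i) w)).toNat), ← hreg (e i),
      ← G.card_neighborFinset_eq_degree, G.neighborFinset_eq_filter, Finset.card_filter]
    exact Finset.sum_congr rfl fun w _ => by split_ifs with h <;> simp [h]
  have htri' (i j : Fin 8) (hij : decide (G.Adj (e i) (e j))) :
      ∃ k, decide (G.Adj (e i) (e k)) ∧ decide (G.Adj (e j) (e k)) := by
    obtain ⟨w, hw⟩ := htri _ _ (of_decide_eq_true hij)
    exact ⟨e.symm w, by simpa using hw⟩
  refine (contains_of_regular (fun i j => decide (G.Adj (e i) (e j))) hsymm (by simp)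
    (decide_eq_true hone) he hdeg htri').imp (fun h => ?_) fun h => ?_
  · exact nonempty_iso_of_labelling hreg e cycleSq_eight_degree (h.exists_hom hsymm)
  · exact nonempty_iso_of_labelling hreg e G8_degree (h.exists_hom hsymm)
end

section
/- Let G be a 4-regular simple graph on 8 vertices. Then G has no cutset of size at most 2; that is, for every set R of at most 2 vertices of G, the graph G − R is connected. (Hence every 4-regular graph on 8 vertices is 3-connected.) -/
open scoped Classical

/-- If every neighbor of `a ∈ A` lies in `A ∪ R`, then `A ∪ R` has more than `deg a` vertices,
and when it has exactly `deg a + 1` of them, `a` is adjacent to all the others. -/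
theorem SimpleGraph.degree_lt_card_union_and_adj {V : Type*} [Fintype V] (G : SimpleGraph V)
    {A R : Finset V} {a : V} (ha : a ∈ A) (hN : ∀ x, G.Adj a x → x ∈ A ∪ R) :
    G.degree a < (A ∪ R).card ∧
      ((A ∪ R).card ≤ G.degree a + 1 → ∀ x ∈ A ∪ R, x ≠ a → G.Adj a x) := by
  have hmem : a ∈ A ∪ R := Finset.mem_union_left _ ha
  have hsub : G.neighborFinset a ⊆ (A ∪ R).erase a := fun x hx => by
    rw [G.mem_neighborFinset] at hx
    exact Finset.mem_erase.2 ⟨hx.ne', hN x hx⟩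
  have hcard := Finset.card_erase_add_one hmem
  have hle := Finset.card_le_card hsub
  rw [G.card_neighborFinset_eq_degree] at hle
  refine ⟨by omega, fun h x hx hxa => ?_⟩
  have heq := Finset.eq_of_subset_of_card_le hsub
    (by rw [G.card_neighborFinset_eq_degree]; omega)
  rw [← G.mem_neighborFinset, heq]
  exact Finset.mem_erase.2 ⟨hxa, hx⟩

/-- A 4-regular graph on 8 vertices has no cutset of size at most 2: removing any
set of at most 2 vertices leaves a connected graph. -/
theorem fourRegular_eight_no_small_cutset
    {V : Type*} [Fintype V] (G : SimpleGraph V)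
    (hV : Fintype.card V = 8) (hreg : ∀ v, G.degree v = 4)
    (R : Finset V) (hR : R.card ≤ 2) :
    (G.induce {v : V | v ∉ R}).Connected := by
  have hne : Nonempty {v : V | v ∉ R} := by
    obtain ⟨v, -, hv⟩ := Finset.exists_mem_notMem_of_card_lt_card
      (s := R) (t := Finset.univ) (by rw [Finset.card_univ]; omega)
    exact ⟨⟨v, hv⟩⟩
  refine ⟨fun u v => ?_⟩
  by_contra huv
  let A : Finset V := Finset.univ.filter fun x =>
    ∃ h : x ∉ R, (G.induce {v : V | v ∉ R}).Reachable u ⟨x, h⟩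
  let B : Finset V := (A ∪ R)ᶜ
  have hAR : Disjoint A R := Finset.disjoint_left.2 fun x hx =>
    (Finset.mem_filter.1 hx).2.1
  have hBR : Disjoint B R := Finset.disjoint_left.2 fun x hx hxR =>
    Finset.mem_compl.1 hx (Finset.mem_union_right _ hxR)
  have hAB : Disjoint A B := Finset.disjoint_left.2 fun x hx hxB =>
    Finset.mem_compl.1 hxB (Finset.mem_union_left _ hx)
  have hu : u.1 ∈ A := Finset.mem_filter.2 ⟨Finset.mem_univ _, u.2, SimpleGraph.Reachable.rfl⟩
  have hv : v.1 ∈ B := Finset.mem_compl.2 fun h => (Finset.mem_union.1 h).elim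
    (fun h => huv (Finset.mem_filter.1 h).2.2) v.2
  have hNA : ∀ a ∈ A, ∀ x, G.Adj a x → x ∈ A ∪ R := fun a ha x hax => by
    by_cases hx : x ∈ R
    · exact Finset.mem_union_right _ hx
    · obtain ⟨h, hr⟩ := (Finset.mem_filter.1 ha).2
      have hadj : (G.induce {v : V | v ∉ R}).Adj ⟨a, h⟩ ⟨x, hx⟩ := hax
      exact Finset.mem_union_left _
        (Finset.mem_filter.2 ⟨Finset.mem_univ _, hx, hr.trans hadj.reachable⟩)
  have hNB : ∀ b ∈ B, ∀ x, G.Adj b x → x ∈ B ∪ R := fun b hb x hbx => by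
    by_contra hx
    rw [Finset.mem_union, not_or, Finset.mem_compl, not_not] at hx
    have hxA := (Finset.mem_union.1 hx.1).resolve_right hx.2
    exact Finset.mem_compl.1 hb (hNA x hxA b hbx.symm)
  have hcA := (G.degree_lt_card_union_and_adj hu (hNA _ hu)).1
  have hcB := (G.degree_lt_card_union_and_adj hv (hNB _ hv)).1
  have hsum := Finset.card_add_card_compl (A ∪ R)
  change (A ∪ R).card + B.card = _ at hsum
  rw [hreg] at hcA hcB
  have hAc := Finset.card_union_of_disjoint hAR
  have hBc := Finset.card_union_of_disjoint hBR
  obtain ⟨r, hr⟩ : R.Nonempty := Finset.card_pos.1 (by omega)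
  have hsub : A ∪ B ⊆ G.neighborFinset r := fun x hx => by
    rw [G.mem_neighborFinset]
    rcases Finset.mem_union.1 hx with hx | hx
    · exact ((G.degree_lt_card_union_and_adj hx (hNA _ hx)).2 (by rw [hreg]; omega) r
        (Finset.mem_union_right _ hr) fun h => Finset.disjoint_left.1 hAR hx (h ▸ hr)).symm
    · exact ((G.degree_lt_card_union_and_adj hx (hNB _ hx)).2 (by rw [hreg]; omega) r
        (Finset.mem_union_right _ hr) fun h => Finset.disjoint_left.1 hBR hx (h ▸ hr)).symm
  have hle := Finset.card_le_card hsub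
  rw [G.card_neighborFinset_eq_degree, hreg, Finset.card_union_of_disjoint hAB] at hle
  omega
end

section
/- (Reduction rule R1.) Let G be a finite connected simple graph, let x be a vertex of G of degree 2 with neighborhood N_G(x) = {a, b}, and suppose a and b are not adjacent in G. Let G' be the graph obtained from G by deleting x and adding the edge ab. Then G' is connected, G' has the same number of vertices of degree 3 and the same number of vertices of degree at least 4 as G, and the maximum number of leaves of a spanning tree of G is at least the maximum number of leaves of a spanning tree of G'. -/
open scoped Classical

/-- The graph obtained from `G` by deleting the vertex `x` and adding the edge `ab`
(reduction rule R1). -/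
def R1graph {V : Type*} (G : SimpleGraph V) (x a b : V) :
    SimpleGraph {v : V // v ≠ x} :=
  (G ⊔ SimpleGraph.fromEdgeSet {s(a, b)}).induce {v : V | v ≠ x}

open SimpleGraph

theorem SimpleGraph.degree_eq_ncard_neighborSet {V : Type*} (G : SimpleGraph V) (v : V)
    [Fintype (G.neighborSet v)] : G.degree v = (G.neighborSet v).ncard := by
  rw [← card_neighborSet_eq_degree, Set.ncard_eq_toFinset_card', Set.toFinset_card]

/-- A vertex map sending adjacent vertices to mutually reachable vertices preserves
reachability. -/
theorem SimpleGraph.Reachable.map_of_adj {V W : Type*} {G : SimpleGraph V} {H : SimpleGraph W}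
    (f : V → W) (hf : ∀ u v, G.Adj u v → H.Reachable (f u) (f v)) {u v : V}
    (h : G.Reachable u v) : H.Reachable (f u) (f v) := by
  obtain ⟨p⟩ := h
  induction p with
  | nil => exact .refl _
  | cons hadj _ ih => exact (hf _ _ hadj).trans ih

theorem R1graph_adj {V : Type*} {G : SimpleGraph V} {x a b : V} {u v : {v : V // v ≠ x}} :
    (R1graph G x a b).Adj u v ↔
      G.Adj u v ∨ (u.1 ≠ v.1 ∧ ((u.1 = a ∧ v.1 = b) ∨ (u.1 = b ∧ v.1 = a))) := by
  simp only [R1graph, comap_adj, sup_adj, fromEdgeSet_adj, Set.mem_singleton_iff, Sym2.eq_iff,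
    Function.Embedding.subtype_apply]
  tauto

theorem R1graph_degree {V : Type*} [Fintype V] {G : SimpleGraph V} {x a b : V}
    (hN : ∀ v, G.Adj x v ↔ v = a ∨ v = b) (hne : a ≠ b) (hab : ¬ G.Adj a b)
    (v : {v : V // v ≠ x}) : (R1graph G x a b).degree v = G.degree v := by
  have hxa : G.Adj x a := (hN a).2 (.inl rfl)
  have hxb : G.Adj x b := (hN b).2 (.inr rfl)
  rw [degree_eq_ncard_neighborSet, degree_eq_ncard_neighborSet,
    ← Set.ncard_image_of_injective _ Subtype.val_injective]
  obtain ⟨v, hv⟩ := v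
  have key : ∀ w, w ∈ Subtype.val '' (R1graph G x a b).neighborSet ⟨v, hv⟩ ↔
      w ≠ x ∧ (G.Adj v w ∨ (v ≠ w ∧ ((v = a ∧ w = b) ∨ (v = b ∧ w = a)))) := by
    intro w
    simp only [Set.mem_image, mem_neighborSet, R1graph_adj, Subtype.exists,
      exists_and_right, exists_eq_right]
    exact ⟨fun ⟨h, h'⟩ => ⟨h, h'⟩, fun ⟨h, h'⟩ => ⟨h, h'⟩⟩
  by_cases hva : v = a
  · subst hva
    rw [← Set.ncard_exchange (s := G.neighborSet v) (a := b) (b := x) hab hxa.symm]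
    congr 1
    ext w
    rw [key]
    have := hxb.ne
    simp only [Set.mem_insert_iff, Set.mem_sdiff, mem_neighborSet, Set.mem_singleton_iff]
    grind
  by_cases hvb : v = b
  · subst hvb
    rw [← Set.ncard_exchange (s := G.neighborSet v) (a := a) (b := x)
      (fun h => hab h.symm) hxb.symm]
    congr 1
    ext w
    rw [key]
    have := hxa.ne
    simp only [Set.mem_insert_iff, Set.mem_sdiff, mem_neighborSet, Set.mem_singleton_iff]
    grind
  · congr 1
    ext w
    rw [key, mem_neighborSet]
    have hvx : ¬ G.Adj v x := fun h => by
      rcases (hN v).1 h.symm with h | h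
      exacts [hva h, hvb h]
    constructor
    · rintro ⟨-, h | ⟨-, ⟨h, -⟩ | ⟨h, -⟩⟩⟩
      exacts [h, absurd h hva, absurd h hvb]
    · intro h
      exact ⟨fun e => hvx (e ▸ h), .inl h⟩

theorem R1graph_connected {V : Type*} {G : SimpleGraph V} (hG : G.Connected) {x a b : V}
    (hN : ∀ v, G.Adj x v ↔ v = a ∨ v = b) : (R1graph G x a b).Connected := by
  have hax : a ≠ x := ((hN a).2 (.inl rfl)).ne'
  have hbx : b ≠ x := ((hN b).2 (.inr rfl)).ne'
  let f : V → {v : V // v ≠ x} := fun v => if h : v = x then ⟨a, hax⟩ else ⟨v, h⟩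
  have hfx : f x = ⟨a, hax⟩ := dif_pos rfl
  have hf : ∀ v (h : v ≠ x), f v = ⟨v, h⟩ := fun v h => dif_neg h
  have hx : ∀ v, G.Adj x v → (R1graph G x a b).Reachable (f x) (f v) := by
    intro v h
    rcases (hN v).1 h with rfl | rfl
    · rw [hfx, hf v hax]
    · rw [hfx, hf v hbx]
      by_cases hav : a = v
      · subst hav; rfl
      · exact Adj.reachable (R1graph_adj.2 (.inr ⟨hav, .inl ⟨rfl, rfl⟩⟩))
  have : Nonempty {v : V // v ≠ x} := ⟨⟨a, hax⟩⟩
  refine ⟨fun u v => ?_⟩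
  have h := (hG.preconnected u v).map_of_adj (H := R1graph G x a b) f fun u v h => by
    by_cases hu : u = x
    · rw [hu] at h ⊢
      exact hx v h
    by_cases hv : v = x
    · rw [hv] at h ⊢
      exact (hx u h.symm).symm
    · rw [hf u hu, hf v hv]
      exact Adj.reachable (R1graph_adj.2 (.inl h))
  rwa [hf u u.2, hf v v.2] at h

/-- If a predicate on vertex degrees fails at a vertex, then the vertices satisfying it can be
counted in the complement of that vertex. -/
theorem card_subtype_ne_eq {V : Type*} [Fintype V] {x : V} {p : {v : V // v ≠ x} → Prop}
    {q : V → Prop} [DecidablePred p] [DecidablePred q] (hpq : ∀ v, p v ↔ q v.1) (hx : ¬ q x) :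
    Fintype.card {v : {v : V // v ≠ x} // p v} = Fintype.card {v : V // q v} :=
  Fintype.card_congr
    { toFun := fun v => ⟨v.1.1, (hpq _).1 v.2⟩
      invFun := fun v => ⟨⟨v.1, fun h => hx (h ▸ v.2)⟩, (hpq _).2 v.2⟩
      left_inv := fun _ => rfl
      right_inv := fun _ => rfl }

theorem isTree_of_card_edgeFinset {V : Type*} [Fintype V] {x : V}
    {T' : SimpleGraph {v : V // v ≠ x}} (hT' : T'.IsTree) {T : SimpleGraph V} (hT : T.Connected)
    (h : T.edgeFinset.card = T'.edgeFinset.card + 1) : T.IsTree := by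
  rw [isTree_iff_connected_and_card]
  refine ⟨hT, ?_⟩
  have h3 := hT'.card_edgeFinset
  have h5 : Fintype.card {v : V // v ≠ x} = Fintype.card V - 1 := Set.card_ne_eq x
  have h6 : 0 < Fintype.card V := Fintype.card_pos_iff.2 ⟨x⟩
  rw [Nat.card_eq_fintype_card, Nat.card_eq_fintype_card, ← edgeFinset_card]
  omega

/-- Subdividing the edge `ab` of a spanning tree of `G - x + ab` by `x` gives a tree. -/
theorem exists_isTree_of_adj {V : Type*} [Fintype V] {G : SimpleGraph V} {x a b : V}
    (hN : ∀ v, G.Adj x v ↔ v = a ∨ v = b) (hne : a ≠ b)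
    {T' : SimpleGraph {v : V // v ≠ x}} (hle : T' ≤ R1graph G x a b) (hT : T'.IsTree)
    (hax : a ≠ x) (hbx : b ≠ x) (hT'ab : T'.Adj ⟨a, hax⟩ ⟨b, hbx⟩) :
    ∃ T ≤ G, T.IsTree ∧ leafCount T' ≤ leafCount T := by
  obtain ⟨T, hTdef⟩ : ∃ T : SimpleGraph V, T =
    (T'.map (Function.Embedding.subtype (· ≠ x)) \ edge a b) ⊔ edge x a ⊔ edge x b := ⟨_, rfl⟩
  have hadj : ∀ u v (hu : u ≠ x) (hv : v ≠ x), T.Adj u v ↔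
      T'.Adj ⟨u, hu⟩ ⟨v, hv⟩ ∧ ¬ ((u = a ∧ v = b) ∨ (u = b ∧ v = a)) := by
    intro u v hu hv
    have h1 : (T'.map (Function.Embedding.subtype (· ≠ x))).Adj u v ↔ T'.Adj ⟨u, hu⟩ ⟨v, hv⟩ :=
      map_adj_apply (f := Function.Embedding.subtype (· ≠ x)) (a := ⟨u, hu⟩) (b := ⟨v, hv⟩)
    have h2 : T'.Adj ⟨u, hu⟩ ⟨v, hv⟩ → u ≠ v := fun h e => h.ne (Subtype.ext e)
    simp only [hTdef, sup_adj, sdiff_adj, edge_adj, h1]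
    grind
  have hTN : ∀ v, T.Adj x v ↔ v = a ∨ v = b := by
    intro v
    have h1 : ¬ (T'.map (Function.Embedding.subtype (· ≠ x))).Adj x v := by
      rw [map_adj]
      rintro ⟨u, w, -, h, -⟩
      exact u.2 h
    simp only [hTdef, sup_adj, sdiff_adj, edge_adj, h1]
    grind
  have hTab : ¬ T.Adj a b := by
    rw [hadj a b hax hbx]
    tauto
  have hR : R1graph T x a b = T' := by
    ext u v
    rw [R1graph_adj, hadj u v u.2 v.2]
    constructor
    · rintro (h | ⟨-, ⟨h, h'⟩ | ⟨h, h'⟩⟩)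
      · exact h.1
      · convert hT'ab
      · convert hT'ab.symm
    · intro h
      have : u.1 ≠ v.1 := fun e => h.ne (Subtype.ext e)
      have : T'.Adj ⟨u.1, u.2⟩ ⟨v.1, v.2⟩ := h
      tauto
  have hdeg : ∀ v : {v : V // v ≠ x}, T'.degree v = T.degree v := by
    intro v
    have h := R1graph_degree hTN hne hTab v
    rw [degree_eq_ncard_neighborSet] at h ⊢
    rwa [hR] at h
  have hdegx : T.degree x = 2 := by
    rw [degree_eq_ncard_neighborSet, ← Set.ncard_pair hne]
    congr 1
    ext v
    exact hTN v
  have hTG : T ≤ G := by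
    intro u v h
    by_cases hu : u = x
    · rw [hu] at h ⊢
      exact (hN v).2 ((hTN v).1 h)
    by_cases hv : v = x
    · rw [hv] at h ⊢
      exact ((hN u).2 ((hTN u).1 h.symm)).symm
    · obtain ⟨h1, h2⟩ := (hadj u v hu hv).1 h
      rcases R1graph_adj.1 (hle h1) with h | h
      exacts [h, absurd h.2 h2]
  have hxa : T.Adj x a := (hTN a).2 (.inl rfl)
  have hxb : T.Adj x b := (hTN b).2 (.inr rfl)
  have hconn : T.Connected := by
    have hreach : ∀ u, T.Reachable u a := by
      intro u
      by_cases hu : u = x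
      · exact hu ▸ hxa.reachable
      refine (hT.connected.preconnected ⟨u, hu⟩ ⟨a, hax⟩).map_of_adj (H := T)
        Subtype.val fun v w h => ?_
      by_cases hvw : (v.1 = a ∧ w.1 = b) ∨ (v.1 = b ∧ w.1 = a)
      · rcases hvw with ⟨h, h'⟩ | ⟨h, h'⟩
        · rw [h, h']; exact hxa.symm.reachable.trans hxb.reachable
        · rw [h, h']; exact hxb.symm.reachable.trans hxa.reachable
      · exact Adj.reachable ((hadj v w v.2 w.2).2 ⟨h, hvw⟩)
    have : Nonempty V := ⟨a⟩
    exact ⟨fun u v => (hreach u).trans (hreach v).symm⟩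
  refine ⟨T, hTG, ?_, ?_⟩
  · refine isTree_of_card_edgeFinset hT hconn ?_
    have h1 := T.sum_degrees_eq_twice_card_edges
    have h2 := T'.sum_degrees_eq_twice_card_edges
    have h3 := Fintype.sum_eq_add_sum_subtype_ne (fun v => T.degree v) x
    rw [h1, hdegx, ← Fintype.sum_congr _ _ hdeg, h2] at h3
    omega
  · exact (card_subtype_ne_eq (p := fun v => T'.degree v = 1) (q := fun v => T.degree v = 1)
      (fun v => by rw [hdeg v]) (by omega)).le

/-- Attaching `x` as a pendant vertex at `a` to a spanning tree of `G - x` gives a tree. -/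
theorem exists_isTree_of_not_adj {V : Type*} [Fintype V] {G : SimpleGraph V} {x a : V}
    (hxa : G.Adj x a) {T' : SimpleGraph {v : V // v ≠ x}}
    (hle : ∀ u v, T'.Adj u v → G.Adj u v) (hT : T'.IsTree) :
    ∃ T ≤ G, T.IsTree ∧ leafCount T' ≤ leafCount T := by
  obtain ⟨T, hTdef⟩ : ∃ T : SimpleGraph V,
    T = T'.map (Function.Embedding.subtype (· ≠ x)) ⊔ edge x a := ⟨_, rfl⟩
  have hax : a ≠ x := hxa.ne'
  have hadj : ∀ u v (hu : u ≠ x) (hv : v ≠ x), T.Adj u v ↔ T'.Adj ⟨u, hu⟩ ⟨v, hv⟩ := by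
    intro u v hu hv
    have h1 : (T'.map (Function.Embedding.subtype (· ≠ x))).Adj u v ↔ T'.Adj ⟨u, hu⟩ ⟨v, hv⟩ :=
      map_adj_apply (f := Function.Embedding.subtype (· ≠ x)) (a := ⟨u, hu⟩) (b := ⟨v, hv⟩)
    simp only [hTdef, sup_adj, edge_adj, h1]
    grind
  have hmapx : ∀ v, ¬ (T'.map (Function.Embedding.subtype (· ≠ x))).Adj x v := by
    intro v
    rw [map_adj]
    rintro ⟨u, w, -, h, -⟩
    exact u.2 h
  have hTN : ∀ v, T.Adj x v ↔ v = a := by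
    intro v
    simp only [hTdef, sup_adj, edge_adj, hmapx v]
    grind
  have hdegx : T.degree x = 1 := by
    rw [degree_eq_ncard_neighborSet, ← Set.ncard_singleton a]
    congr 1
    ext v
    exact hTN v
  have hdeg : ∀ v : {v : V // v ≠ x}, v.1 ≠ a → T.degree v = T'.degree v := by
    intro v hva
    rw [degree_eq_ncard_neighborSet, degree_eq_ncard_neighborSet,
      ← Set.ncard_image_of_injective _ Subtype.val_injective]
    congr 1
    ext w
    constructor
    · intro (h : T.Adj v w)
      have hw : w ≠ x := by
        intro e
        rw [e] at h
        exact hva ((hTN v).1 h.symm)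
      exact ⟨⟨w, hw⟩, (hadj v w v.2 hw).1 h, rfl⟩
    · rintro ⟨w, h, rfl⟩
      exact (hadj v w v.2 w.2).2 h
  have hconn : T.Connected := by
    have hreach : ∀ u, T.Reachable u a := by
      intro u
      by_cases hu : u = x
      · exact hu ▸ ((hTN a).2 rfl).reachable
      · exact (hT.connected.preconnected ⟨u, hu⟩ ⟨a, hax⟩).map_of_adj (H := T)
          Subtype.val fun v w h => Adj.reachable ((hadj v w v.2 w.2).2 h)
    have : Nonempty V := ⟨a⟩
    exact ⟨fun u v => (hreach u).trans (hreach v).symm⟩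
  refine ⟨T, ?_, ?_, ?_⟩
  · rw [hTdef]
    refine sup_le ?_ ((edge_le_iff G).2 (.inr hxa))
    intro u v h
    rw [map_adj] at h
    obtain ⟨u, v, h, rfl, rfl⟩ := h
    exact hle u v h
  · refine isTree_of_card_edgeFinset hT hconn ?_
    rw [← card_edgeFinset_map (Function.Embedding.subtype (· ≠ x)) T',
      ← card_edgeFinset_sup_edge _ (hmapx a) hxa.ne]
    congr!
  · let f : {v : V // v ≠ x} → V := fun v => if v.1 = a then x else v.1
    have hf : Function.Injective f := by
      intro u v h
      have := u.2
      have := v.2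
      apply Subtype.ext
      grind
    have hleaf : ∀ v, T'.degree v = 1 → T.degree (f v) = 1 := by
      intro v hv
      by_cases hva : v.1 = a
      · rwa [show f v = x from if_pos hva]
      · rw [show f v = v from if_neg hva, hdeg v hva, hv]
    exact Fintype.card_le_of_injective (Subtype.map f hleaf) (Subtype.map_injective hleaf hf)

/-- Reduction rule R1: if `x` has degree 2 with nonadjacent neighbors `a, b`, then the
graph `G' = G - x + ab` is connected, has the same number of vertices of degree 3 and
of degree at least 4 as `G`, and the maximum number of leaves of a spanning tree of `G`
is at least that of `G'`. -/
theorem reduction_R1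
    {V : Type*} [Fintype V] (G : SimpleGraph V) (hG : G.Connected)
    (x a b : V) (hx : G.degree x = 2) (hN : G.neighborSet x = {a, b})
    (hab : ¬ G.Adj a b) :
    (R1graph G x a b).Connected ∧
    Fintype.card {v : {v : V // v ≠ x} // (R1graph G x a b).degree v = 3}
      = Fintype.card {v : V // G.degree v = 3} ∧
    Fintype.card {v : {v : V // v ≠ x} // 4 ≤ (R1graph G x a b).degree v}
      = Fintype.card {v : V // 4 ≤ G.degree v} ∧
    ∀ T' ≤ R1graph G x a b, T'.IsTree →
      ∃ T ≤ G, T.IsTree ∧ leafCount T' ≤ leafCount T := by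
  have hN' : ∀ v, G.Adj x v ↔ v = a ∨ v = b := fun v => by
    rw [← mem_neighborSet, hN, Set.mem_insert_iff, Set.mem_singleton_iff]
  have hne : a ≠ b := by
    rintro rfl
    rw [degree_eq_ncard_neighborSet, hN, Set.pair_eq_singleton, Set.ncard_singleton] at hx
    omega
  have hxa : G.Adj x a := (hN' a).2 (.inl rfl)
  have hxb : G.Adj x b := (hN' b).2 (.inr rfl)
  have hdeg := R1graph_degree hN' hne hab
  refine ⟨R1graph_connected hG hN',
    card_subtype_ne_eq (p := fun v => (R1graph G x a b).degree v = 3)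
      (q := fun v => G.degree v = 3) (fun v => by rw [hdeg v]) (by omega),
    card_subtype_ne_eq (p := fun v => 4 ≤ (R1graph G x a b).degree v)
      (q := fun v => 4 ≤ G.degree v) (fun v => by rw [hdeg v]) (by omega),
    fun T' hle hT => ?_⟩
  by_cases h : T'.Adj ⟨a, hxa.ne'⟩ ⟨b, hxb.ne'⟩
  · exact exists_isTree_of_adj hN' hne hle hT _ _ h
  · refine exists_isTree_of_not_adj hxa (fun u v huv => ?_) hT
    rcases R1graph_adj.1 (hle huv) with h' | ⟨-, ⟨hu, hv⟩ | ⟨hu, hv⟩⟩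
    · exact h'
    · rw [show u = ⟨a, hxa.ne'⟩ from Subtype.ext hu,
        show v = ⟨b, hxb.ne'⟩ from Subtype.ext hv] at huv
      exact absurd huv h
    · rw [show u = ⟨b, hxb.ne'⟩ from Subtype.ext hu,
        show v = ⟨a, hxa.ne'⟩ from Subtype.ext hv] at huv
      exact absurd huv.symm h
end

section
/- (Reduction rule R2.) Let G be a finite connected simple graph, let a_1 and a_2 be adjacent vertices of G, both of degree 3, such that N_G(a_1) ∩ N_G(a_2) = ∅. Let G' = G · a_1a_2 be the graph obtained from G by contracting the edge a_1a_2 into a single vertex a. Then G' is a simple connected graph, the vertex a has degree 4 in G' (so G' has the same cost c(G') = c(G)), and the maximum number of leaves of a spanning tree of G is at least the maximum number of leaves of a spanning tree of G'. -/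
open scoped Classical

/-- The graph `G · a₁a₂` obtained from `G` by contracting the edge `a₁a₂` into the
single vertex represented by `a₁` (the vertex `a₂` is removed, and the new vertex is
adjacent to exactly the vertices adjacent in `G` to `a₁` or to `a₂`). -/
def contractEdge {V : Type*} (G : SimpleGraph V) (a₁ a₂ : V) :
    SimpleGraph {v : V // v ≠ a₂} :=
  SimpleGraph.fromRel (fun u v =>
    (G.Adj u v ∧ (u : V) ≠ a₁ ∧ (v : V) ≠ a₁) ∨
    ((u : V) = a₁ ∧ (G.Adj a₁ v ∨ G.Adj a₂ v)))

/-- The quotient map `V → V(G · a₁a₂)`, sending `a₂` to `a₁` and fixing all other vertices. -/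
noncomputable def contractMap {V : Type*} {a₁ a₂ : V} (h : a₁ ≠ a₂) (v : V) : {v : V // v ≠ a₂} :=
  if hv : v = a₂ then ⟨a₁, h⟩ else ⟨v, hv⟩

/-- The preimage in `G` of a graph on the vertices of `G · a₁a₂`, together with the edge `a₁a₂`. -/
def uncontract {V : Type*} (G : SimpleGraph V) {a₁ a₂ : V} (h : a₁ ≠ a₂)
    (H : SimpleGraph {v : V // v ≠ a₂}) : SimpleGraph V where
  Adj u v := G.Adj u v ∧
    (H.Adj (contractMap h u) (contractMap h v) ∨ contractMap h u = contractMap h v)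
  symm := ⟨fun _ _ huv => ⟨huv.1.symm, huv.2.imp (fun e => e.symm) Eq.symm⟩⟩

section Contraction

variable {V : Type*} {G : SimpleGraph V} {a₁ a₂ : V}

theorem contractMap_right (h : a₁ ≠ a₂) : contractMap h a₂ = ⟨a₁, h⟩ := by
  simp [contractMap]

theorem contractMap_of_ne (h : a₁ ≠ a₂) {v : V} (hv : v ≠ a₂) : contractMap h v = ⟨v, hv⟩ := by
  simp [contractMap, hv]

theorem contractMap_left (h : a₁ ≠ a₂) : contractMap h a₁ = ⟨a₁, h⟩ :=
  contractMap_of_ne h h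

theorem contractMap_coe (h : a₁ ≠ a₂) (x : {v : V // v ≠ a₂}) : contractMap h x = x :=
  contractMap_of_ne h x.2

theorem contractMap_eq_iff (h : a₁ ≠ a₂) {u : V} {x : {v : V // v ≠ a₂}} :
    contractMap h u = x ↔ u = x ∨ (u = a₂ ∧ (x : V) = a₁) := by
  by_cases hu : u = a₂
  · subst hu
    rw [contractMap_right, Subtype.ext_iff]
    have := x.2
    grind
  · rw [contractMap_of_ne h hu, Subtype.ext_iff]
    grind

theorem contractMap_eq_left_iff (h : a₁ ≠ a₂) {u : V} :
    contractMap h u = ⟨a₁, h⟩ ↔ u = a₁ ∨ u = a₂ := by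
  simp [contractMap_eq_iff]

theorem contractEdge_adj_iff (h : a₁ ≠ a₂) {x y : {v : V // v ≠ a₂}} :
    (contractEdge G a₁ a₂).Adj x y ↔
      x ≠ y ∧ ∃ u v, contractMap h u = x ∧ contractMap h v = y ∧ G.Adj u v := by
  obtain ⟨x, hx⟩ := x
  obtain ⟨y, hy⟩ := y
  simp only [contractEdge, SimpleGraph.fromRel_adj, contractMap_eq_iff, ne_eq, Subtype.mk.injEq]
  refine and_congr_right fun hxy => ⟨?_, ?_⟩
  · rintro ((⟨e, -, -⟩ | ⟨rfl, e | e⟩) | (⟨e, -, -⟩ | ⟨rfl, e | e⟩))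
    · exact ⟨x, y, .inl rfl, .inl rfl, e⟩
    · exact ⟨x, y, .inl rfl, .inl rfl, e⟩
    · exact ⟨a₂, y, .inr ⟨rfl, rfl⟩, .inl rfl, e⟩
    · exact ⟨x, y, .inl rfl, .inl rfl, e.symm⟩
    · exact ⟨x, y, .inl rfl, .inl rfl, e.symm⟩
    · exact ⟨x, a₂, .inl rfl, .inr ⟨rfl, rfl⟩, e.symm⟩
  · rintro ⟨u, v, rfl | ⟨rfl, rfl⟩, rfl | ⟨rfl, rfl⟩, e⟩
    · have := e.symm
      by_cases u = a₁ <;> by_cases v = a₁ <;> simp_all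
    · exact .inr (.inr ⟨rfl, .inr e.symm⟩)
    · exact .inl (.inr ⟨rfl, .inr e⟩)
    · exact absurd rfl hxy

theorem contractEdge_adj_contractMap (h : a₁ ≠ a₂) {u v : V} (e : G.Adj u v)
    (hne : contractMap h u ≠ contractMap h v) :
    (contractEdge G a₁ a₂).Adj (contractMap h u) (contractMap h v) :=
  (contractEdge_adj_iff h).2 ⟨hne, u, v, rfl, rfl, e⟩

theorem uncontract_le (h : a₁ ≠ a₂) (H : SimpleGraph {v : V // v ≠ a₂}) :
    uncontract G h H ≤ G := fun _ _ e => e.1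

theorem uncontract_contractEdge (h : a₁ ≠ a₂) :
    uncontract G h (contractEdge G a₁ a₂) = G := by
  refine le_antisymm (uncontract_le h _) fun u v e => ⟨e, ?_⟩
  by_cases hne : contractMap h u = contractMap h v
  · exact .inr hne
  · exact .inl (contractEdge_adj_contractMap h e hne)

theorem uncontract_adj_contracted (hadj : G.Adj a₁ a₂) (H : SimpleGraph {v : V // v ≠ a₂}) :
    (uncontract G hadj.ne H).Adj a₁ a₂ :=
  ⟨hadj, .inr (by rw [contractMap_left, contractMap_right])⟩

theorem exists_uncontract_adj (h : a₁ ≠ a₂) {H : SimpleGraph {v : V // v ≠ a₂}}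
    (hH : H ≤ contractEdge G a₁ a₂) {x y : {v : V // v ≠ a₂}} (e : H.Adj x y) :
    ∃ u v, contractMap h u = x ∧ contractMap h v = y ∧ (uncontract G h H).Adj u v := by
  obtain ⟨-, u, v, rfl, rfl, e'⟩ := (contractEdge_adj_iff h).1 (hH e)
  exact ⟨u, v, rfl, rfl, e', .inl e⟩

theorem SimpleGraph.Reachable.of_forall_adj {W : Type*} {K : SimpleGraph W} (f : V → W)
    (hf : ∀ u v, G.Adj u v → K.Reachable (f u) (f v)) {u v : V} (huv : G.Reachable u v) :
    K.Reachable (f u) (f v) := by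
  obtain ⟨p⟩ := huv
  induction p with
  | nil => rfl
  | cons e _ ih => exact (hf _ _ e).trans ih

theorem contractEdge_connected (h : a₁ ≠ a₂) (hG : G.Connected) :
    (contractEdge G a₁ a₂).Connected := by
  have : Nonempty {v : V // v ≠ a₂} := ⟨⟨a₁, h⟩⟩
  refine ⟨fun x y => ?_⟩
  have hxy := SimpleGraph.Reachable.of_forall_adj (K := contractEdge G a₁ a₂) (contractMap h)
    (fun u v e => ?_) (hG.preconnected x y)
  · rwa [contractMap_coe, contractMap_coe] at hxy
  · by_cases hne : contractMap h u = contractMap h v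
    · rw [hne]
    · exact (contractEdge_adj_contractMap h e hne).reachable

theorem uncontract_reachable_contractMap (hadj : G.Adj a₁ a₂) (H : SimpleGraph {v : V // v ≠ a₂})
    (u : V) : (uncontract G hadj.ne H).Reachable u (contractMap hadj.ne u) := by
  by_cases hu : u = a₂
  · subst hu
    rw [contractMap_right]
    exact (uncontract_adj_contracted hadj H).symm.reachable
  · rw [contractMap_of_ne _ hu]

theorem uncontract_connected (hadj : G.Adj a₁ a₂) {H : SimpleGraph {v : V // v ≠ a₂}}
    (hH : H ≤ contractEdge G a₁ a₂) (hc : H.Connected) :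
    (uncontract G hadj.ne H).Connected := by
  have : Nonempty V := ⟨a₁⟩
  have hπ := uncontract_reachable_contractMap hadj H
  refine ⟨fun u v => (hπ u).trans (.trans ?_ (hπ v).symm)⟩
  refine SimpleGraph.Reachable.of_forall_adj Subtype.val (fun x y e => ?_)
    (hc.preconnected (contractMap hadj.ne u) (contractMap hadj.ne v))
  obtain ⟨u, v, rfl, rfl, e'⟩ := exists_uncontract_adj hadj.ne hH e
  exact (hπ u).symm.trans (e'.reachable.trans (hπ v))

variable [Fintype V]

theorem degree_uncontract_of_ne (h : a₁ ≠ a₂)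
    (hN : G.neighborSet a₁ ∩ G.neighborSet a₂ = ∅) {H : SimpleGraph {v : V // v ≠ a₂}}
    (hH : H ≤ contractEdge G a₁ a₂) (x : {v : V // v ≠ a₂}) (hx : (x : V) ≠ a₁) :
    (uncontract G h H).degree x = H.degree x := by
  have hd : ∀ w, G.Adj w a₁ → G.Adj w a₂ → False := fun w e₁ e₂ =>
    (Set.ext_iff.1 hN w).1 ⟨e₁.symm, e₂.symm⟩
  simp only [← SimpleGraph.card_neighborFinset_eq_degree]
  refine Finset.card_nbij (contractMap h) (fun u hu => ?_) (fun u hu v hv huv => ?_)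
    (fun y hy => ?_)
  · simp only [Finset.mem_coe, SimpleGraph.mem_neighborFinset] at hu ⊢
    obtain ⟨e, e' | e'⟩ := hu
    · rwa [contractMap_coe] at e'
    · rw [contractMap_coe, eq_comm, contractMap_eq_iff] at e'
      obtain e' | e' := e'
      · exact absurd e' e.ne'
      · exact absurd e'.2 hx
  · simp only [Finset.mem_coe, SimpleGraph.mem_neighborFinset] at hu hv
    have h₁ := hd x
    have e₁ := hu.1
    have e₂ := hv.1
    unfold contractMap at huv
    grind
  · simp only [Finset.mem_coe, SimpleGraph.mem_neighborFinset] at hy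
    obtain ⟨u, v, hu, rfl, e⟩ := exists_uncontract_adj h hH hy
    obtain rfl | hu := (contractMap_eq_iff h).1 hu
    · exact ⟨v, by simpa using e, rfl⟩
    · exact absurd hu.2 hx

theorem degree_uncontract_add_degree_uncontract (hadj : G.Adj a₁ a₂)
    (hN : G.neighborSet a₁ ∩ G.neighborSet a₂ = ∅) {H : SimpleGraph {v : V // v ≠ a₂}}
    (hH : H ≤ contractEdge G a₁ a₂) :
    (uncontract G hadj.ne H).degree a₁ + (uncontract G hadj.ne H).degree a₂ =
      H.degree ⟨a₁, hadj.ne⟩ + 2 := by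
  set T := uncontract G hadj.ne H
  have hd : ∀ w, G.Adj a₁ w → G.Adj a₂ w → False := fun w e₁ e₂ =>
    (Set.ext_iff.1 hN w).1 ⟨e₁, e₂⟩
  have e₁₂ : T.Adj a₁ a₂ := uncontract_adj_contracted hadj H
  have hdisj : Disjoint ((T.neighborFinset a₁).erase a₂) ((T.neighborFinset a₂).erase a₁) := by
    rw [Finset.disjoint_left]
    intro w hw₁ hw₂
    simp only [Finset.mem_erase, SimpleGraph.mem_neighborFinset] at hw₁ hw₂
    exact hd w hw₁.2.1 hw₂.2.1
  have hmem : ∀ w, w ∈ (T.neighborFinset a₁).erase a₂ ∪ (T.neighborFinset a₂).erase a₁ ↔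
      w ≠ a₁ ∧ w ≠ a₂ ∧ (T.Adj a₁ w ∨ T.Adj a₂ w) := by
    intro w
    have n₁ := T.loopless.irrefl a₁
    have n₂ := T.loopless.irrefl a₂
    simp only [Finset.mem_union, Finset.mem_erase, SimpleGraph.mem_neighborFinset]
    grind
  have hcard : ((T.neighborFinset a₁).erase a₂ ∪ (T.neighborFinset a₂).erase a₁).card =
      H.degree ⟨a₁, hadj.ne⟩ := by
    rw [← SimpleGraph.card_neighborFinset_eq_degree]
    refine Finset.card_nbij (contractMap hadj.ne) (fun w hw => ?_) (fun u hu v hv huv => ?_)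
      (fun y hy => ?_)
    · rw [Finset.mem_coe, hmem] at hw
      simp only [Finset.mem_coe, SimpleGraph.mem_neighborFinset]
      obtain ⟨hw₁, hw₂, ⟨-, e⟩ | ⟨-, e⟩⟩ := hw
      · rw [contractMap_left, eq_comm, contractMap_eq_left_iff] at e
        tauto
      · rw [contractMap_right, eq_comm, contractMap_eq_left_iff] at e
        tauto
    · rw [Finset.mem_coe, hmem] at hu hv
      rw [contractMap_of_ne _ hu.2.1, contractMap_of_ne _ hv.2.1] at huv
      exact congrArg Subtype.val huv
    · simp only [Finset.mem_coe, SimpleGraph.mem_neighborFinset] at hy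
      obtain ⟨u, v, hu, rfl, e⟩ := exists_uncontract_adj hadj.ne hH hy
      refine ⟨v, ?_, rfl⟩
      have hv : ¬(v = a₁ ∨ v = a₂) := fun hv =>
        hy.ne ((contractMap_eq_left_iff hadj.ne).2 hv).symm
      rw [Finset.mem_coe, hmem]
      obtain rfl | rfl := (contractMap_eq_left_iff hadj.ne).1 hu
      · exact ⟨fun h => hv (.inl h), fun h => hv (.inr h), .inl e⟩
      · exact ⟨fun h => hv (.inl h), fun h => hv (.inr h), .inr e⟩
  rw [Finset.card_union_of_disjoint hdisj] at hcard
  have c₁ := Finset.card_erase_add_one ((T.mem_neighborFinset a₁ a₂).2 e₁₂)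
  have c₂ := Finset.card_erase_add_one ((T.mem_neighborFinset a₂ a₁).2 e₁₂.symm)
  rw [SimpleGraph.card_neighborFinset_eq_degree] at c₁ c₂
  omega

theorem sum_add_eq_sum_contract_add (h : a₁ ≠ a₂) (f : V → ℕ) (g : {v : V // v ≠ a₂} → ℕ)
    (hfg : ∀ x : {v : V // v ≠ a₂}, (x : V) ≠ a₁ → f x = g x) :
    ∑ v, f v + g ⟨a₁, h⟩ = ∑ x, g x + f a₁ + f a₂ := by
  have hf : ∑ v, f v = f a₂ + ∑ x : {v : V // v ≠ a₂}, f x := by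
    rw [← Finset.add_sum_erase _ f (Finset.mem_univ a₂)]
    congr 1
    exact (Finset.sum_subtype _ (by simp) f)
  have hg := Finset.add_sum_erase _ g (Finset.mem_univ ⟨a₁, h⟩)
  have hf' := Finset.add_sum_erase _ (fun x : {v : V // v ≠ a₂} => f x) (Finset.mem_univ ⟨a₁, h⟩)
  have hs : ∑ x ∈ Finset.univ.erase (⟨a₁, h⟩ : {v : V // v ≠ a₂}), f x =
      ∑ x ∈ Finset.univ.erase ⟨a₁, h⟩, g x :=
    Finset.sum_congr rfl fun x hx => hfg x fun hx' => (Finset.mem_erase.1 hx).1 (Subtype.ext hx')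
  simp only at hf'
  omega

theorem card_degree_uncontract_add (h : a₁ ≠ a₂)
    (hN : G.neighborSet a₁ ∩ G.neighborSet a₂ = ∅) {H : SimpleGraph {v : V // v ≠ a₂}}
    (hH : H ≤ contractEdge G a₁ a₂) (P : ℕ → Prop) [DecidablePred P] :
    Fintype.card {v : V // P ((uncontract G h H).degree v)} +
        (if P (H.degree ⟨a₁, h⟩) then 1 else 0) =
      Fintype.card {x : {v : V // v ≠ a₂} // P (H.degree x)} +
        (if P ((uncontract G h H).degree a₁) then 1 else 0) +
        (if P ((uncontract G h H).degree a₂) then 1 else 0) := by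
  simp only [Fintype.card_subtype, Finset.card_filter]
  exact sum_add_eq_sum_contract_add h (fun v => if P ((uncontract G h H).degree v) then 1 else 0)
    (fun x => if P (H.degree x) then 1 else 0)
    fun x hx => by simp only [degree_uncontract_of_ne h hN hH x hx]

theorem uncontract_isTree (hadj : G.Adj a₁ a₂)
    (hN : G.neighborSet a₁ ∩ G.neighborSet a₂ = ∅) {H : SimpleGraph {v : V // v ≠ a₂}}
    (hH : H ≤ contractEdge G a₁ a₂) (ht : H.IsTree) :
    (uncontract G hadj.ne H).IsTree := by
  refine SimpleGraph.isTree_iff_connected_and_card.2 ⟨uncontract_connected hadj hH ht.1, ?_⟩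
  have hs := sum_add_eq_sum_contract_add hadj.ne (fun v => (uncontract G hadj.ne H).degree v)
    (fun x => H.degree x) (degree_uncontract_of_ne hadj.ne hN hH)
  have ha := degree_uncontract_add_degree_uncontract hadj hN hH
  have hE := (SimpleGraph.isTree_iff_connected_and_card.1 ht).2
  have hV := sum_add_eq_sum_contract_add hadj.ne (fun _ => 1) (fun _ => 1) fun _ _ => rfl
  rw [SimpleGraph.sum_degrees_eq_twice_card_edges, SimpleGraph.sum_degrees_eq_twice_card_edges]
    at hs
  simp only [Finset.sum_const, Finset.card_univ, smul_eq_mul, mul_one] at hV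
  rw [Nat.card_eq_fintype_card, Nat.card_eq_fintype_card, ← SimpleGraph.edgeFinset_card] at hE ⊢
  omega

theorem leafCount_le_leafCount_uncontract (hadj : G.Adj a₁ a₂)
    (hN : G.neighborSet a₁ ∩ G.neighborSet a₂ = ∅) {H : SimpleGraph {v : V // v ≠ a₂}}
    (hH : H ≤ contractEdge G a₁ a₂) :
    leafCount H ≤ leafCount (uncontract G hadj.ne H) := by
  have hc := card_degree_uncontract_add hadj.ne hN hH (fun d => d = 1)
  have ha := degree_uncontract_add_degree_uncontract hadj hN hH
  have e := uncontract_adj_contracted hadj H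
  have p₁ := (SimpleGraph.degree_pos_iff_exists_adj _ a₁).2 ⟨a₂, e⟩
  have p₂ := (SimpleGraph.degree_pos_iff_exists_adj _ a₂).2 ⟨a₁, e.symm⟩
  unfold leafCount
  split_ifs at hc <;> omega

end Contraction

/-- Reduction rule R2: if `a₁, a₂` are adjacent vertices of degree 3 with disjoint
neighborhoods, then the contracted graph `G' = G · a₁a₂` is connected, the glued
vertex has degree 4 in `G'` (so `G'` has the same cost
`c = (2/5)·#{deg ≥ 4} + (1/5)·#{deg = 3}` as `G`), and the maximum number of leaves
of a spanning tree of `G` is at least that of `G'`. -/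
theorem reduction_R2
    {V : Type*} [Fintype V] (G : SimpleGraph V) (hG : G.Connected)
    (a₁ a₂ : V) (hadj : G.Adj a₁ a₂)
    (h₁ : G.degree a₁ = 3) (h₂ : G.degree a₂ = 3)
    (hN : G.neighborSet a₁ ∩ G.neighborSet a₂ = ∅) :
    (contractEdge G a₁ a₂).Connected ∧
    (contractEdge G a₁ a₂).degree (⟨a₁, hadj.ne⟩ : {v : V // v ≠ a₂}) = 4 ∧
    (2 / 5 : ℚ) * Fintype.card {v : {v : V // v ≠ a₂} // 4 ≤ (contractEdge G a₁ a₂).degree v}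
        + (1 / 5 : ℚ) * Fintype.card {v : {v : V // v ≠ a₂} // (contractEdge G a₁ a₂).degree v = 3}
      = (2 / 5 : ℚ) * Fintype.card {v : V // 4 ≤ G.degree v}
        + (1 / 5 : ℚ) * Fintype.card {v : V // G.degree v = 3} ∧
    ∀ T' ≤ contractEdge G a₁ a₂, T'.IsTree →
      ∃ T ≤ G, T.IsTree ∧ leafCount T' ≤ leafCount T := by
  have hlo := le_refl (contractEdge G a₁ a₂)
  have ha := degree_uncontract_add_degree_uncontract hadj hN hlo
  have hc := card_degree_uncontract_add hadj.ne hN hlo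
  rw [uncontract_contractEdge hadj.ne] at ha hc
  rw [h₁, h₂] at ha
  have h4 : (contractEdge G a₁ a₂).degree (⟨a₁, hadj.ne⟩ : {v : V // v ≠ a₂}) = 4 := by omega
  refine ⟨contractEdge_connected hadj.ne hG, h4, ?_, fun T' hT' ht =>
    ⟨uncontract G hadj.ne T', uncontract_le hadj.ne T', uncontract_isTree hadj hN hT' ht,
      leafCount_le_leafCount_uncontract hadj hN hT'⟩⟩
  have c4 := hc (fun d => 4 ≤ d)
  have c3 := hc (fun d => d = 3)
  simp only [h4, h₁, h₂] at c4 c3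
  norm_num at c4 c3
  rw [← c4, c3]
  push_cast
  ring
end

section
/- For every integer n ≥ 2, the graph H_n is connected, has exactly 2n vertices of degree 3 and exactly 4n vertices of degree 4, and the maximum number of leaves of a spanning tree of H_n equals 2n + 2 = (2/5)·(4n) + (1/5)·(2n) + 2. Hence the bound of the main theorem with additive constant 2 is attained by infinitely many graphs. -/
open scoped Classical

/-- The graph `H_n`: for each `i ∈ ZMod n` a block on vertices
`x_i, y_i, z_i, v_i, a_i, b_i` (encoded as `(i, 0), …, (i, 5)`), where
`x_i, y_i, z_i, v_i` are pairwise adjacent, `a_i` is adjacent to `x_i, y_i`,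
`b_i` is adjacent to `z_i, v_i`, and `b_i` is adjacent to `a_{i+1}`. -/
def Hgraph (n : ℕ) : SimpleGraph (ZMod n × Fin 6) :=
  SimpleGraph.fromRel (fun u v =>
    (u.1 = v.1 ∧ ((u.2.val < 4 ∧ v.2.val < 4) ∨
      (u.2.val = 4 ∧ (v.2.val = 0 ∨ v.2.val = 1)) ∨
      (u.2.val = 5 ∧ (v.2.val = 2 ∨ v.2.val = 3)))) ∨
    (v.1 = u.1 + 1 ∧ u.2.val = 5 ∧ v.2.val = 4))

namespace SimpleGraph

variable {V : Type*} {T : SimpleGraph V}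

/-- A connected graph has an edge across every cut. -/
lemma Connected.exists_adj_mem_notMem (hT : T.Connected) (C : Set V) {p q : V}
    (hp : p ∈ C) (hq : q ∉ C) : ∃ u ∈ C, ∃ w ∉ C, T.Adj u w := by
  obtain ⟨W⟩ := hT.preconnected p q
  obtain ⟨d, -, h1, h2⟩ := W.exists_boundary_dart C hp hq
  exact ⟨_, h1, _, h2, d.adj⟩

lemma degree_ne_one_of_adj_of_adj {v w w' : V} [Fintype (T.neighborSet v)] (hne : w ≠ w')
    (h : T.Adj v w) (h' : T.Adj v w') : T.degree v ≠ 1 := fun hd =>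
  hne ((degree_eq_one_iff_existsUnique_adj.1 hd).unique h h')

end SimpleGraph

namespace Hgraph

variable {n : ℕ}

/-- Adjacency inside one block of `H_n`. -/
def BlockAdj (u w : Fin 6) : Prop :=
  u ≠ w ∧ ((u.val < 4 ∧ w.val < 4) ∨
    (u.val = 4 ∧ w.val < 2) ∨ (w.val = 4 ∧ u.val < 2) ∨
    (u.val = 5 ∧ (w.val = 2 ∨ w.val = 3)) ∨ (w.val = 5 ∧ (u.val = 2 ∨ u.val = 3)))

instance : DecidableRel BlockAdj := fun u w => by unfold BlockAdj; infer_instance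

lemma adj_iff (hn : 2 ≤ n) {i j : ZMod n} {u w : Fin 6} :
    (Hgraph n).Adj (i, u) (j, w) ↔
      (i = j ∧ BlockAdj u w) ∨ (j = i + 1 ∧ u = 5 ∧ w = 4) ∨ (i = j + 1 ∧ u = 4 ∧ w = 5) := by
  have : Fact (1 < n) := ⟨hn⟩
  simp only [Hgraph, SimpleGraph.fromRel_adj, BlockAdj, ne_eq, Prod.mk.injEq, Fin.ext_iff]
  have h4 : ((4 : Fin 6) : ℕ) = 4 := rfl
  have h5 : ((5 : Fin 6) : ℕ) = 5 := rfl
  rw [h4, h5]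
  by_cases hij : i = j
  · subst hij
    have : i ≠ i + 1 := by simp
    simp only [this, true_and, false_and, or_false]
    omega
  · have hji : j ≠ i := fun h => hij h.symm
    simp only [hij, hji, false_and, not_false_eq_true, true_and, false_or]
    tauto

section UpperBound

variable {T : SimpleGraph (ZMod n × Fin 6)}

/-- The edges of `T` inside block `i` do not join `a_i` to `b_i`. -/
def BlockSplit (T : SimpleGraph (ZMod n × Fin 6)) (i : ZMod n) : Prop :=
  ∃ S : Set (Fin 6), 4 ∈ S ∧ 5 ∉ S ∧ ∀ u ∈ S, ∀ w ∉ S, ¬ T.Adj (i, u) (i, w)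

/-- The edge `b_i a_{i+1}` belongs to `T`. -/
def Linked (T : SimpleGraph (ZMod n × Fin 6)) (i : ZMod n) : Prop :=
  T.Adj (i, 5) (i + 1, 4)

/-- The ring is interrupted in block `i` or at the edge leaving it. -/
def Broken (T : SimpleGraph (ZMod n × Fin 6)) (i : ZMod n) : Prop :=
  BlockSplit T i ∨ ¬ Linked T i

lemma Broken.exists_set {i : ZMod n} (h : Broken T i) :
    ∃ S : Set (Fin 6), 4 ∈ S ∧ (5 ∈ S → ¬ Linked T i) ∧
      ∀ u ∈ S, ∀ w ∉ S, ¬ T.Adj (i, u) (i, w) := by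
  rcases h with ⟨S, h4, h5, hS⟩ | h
  · exact ⟨S, h4, fun h => absurd h h5, hS⟩
  · exact ⟨Set.univ, trivial, fun _ => h, fun _ _ w hw => absurd (Set.mem_univ w) hw⟩

/-- A cut respected by the edges inside every block must separate the ends of some link. -/
lemma exists_linked_of_cut (hn : 2 ≤ n) (hT : T.Connected) (hle : T ≤ Hgraph n)
    (U : ZMod n → Set (Fin 6)) {p q : ZMod n × Fin 6} (hp : p.2 ∈ U p.1) (hq : q.2 ∉ U q.1)
    (hU : ∀ i, ∀ u ∈ U i, ∀ w ∉ U i, ¬ T.Adj (i, u) (i, w)) :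
    ∃ i, Linked T i ∧ ¬ (5 ∈ U i ↔ 4 ∈ U (i + 1)) := by
  obtain ⟨⟨i, u⟩, hu, ⟨j, w⟩, hw, h⟩ :=
    hT.exists_adj_mem_notMem {v : ZMod n × Fin 6 | v.2 ∈ U v.1} hp hq
  simp only [Set.mem_ofPred_eq] at hu hw
  rcases (adj_iff hn).1 (hle h) with ⟨rfl, -⟩ | ⟨rfl, rfl, rfl⟩ | ⟨rfl, rfl, rfl⟩
  · exact absurd h (hU i u hu w hw)
  · exact ⟨i, h, by tauto⟩
  · exact ⟨j, h.symm, by tauto⟩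

lemma eq_of_broken [NeZero n] (hn : 2 ≤ n) (hT : T.Connected) (hle : T ≤ Hgraph n) {i j : ZMod n}
    (hi : Broken T i) (hj : Broken T j) : i = j := by
  have : Fact (1 < n) := ⟨hn⟩
  by_contra hij
  obtain ⟨S, h4, h5, hS⟩ := hi.exists_set
  obtain ⟨S', h4', h5', hS'⟩ := hj.exists_set
  let U : ZMod n → Set (Fin 6) := fun k =>
    if k = i then Sᶜ else if k = j then S' else {_u | (k - i).val < (j - i).val}
  have hUi : U i = Sᶜ := by simp [U]
  have hUj : U j = S' := by simp [U, Ne.symm hij]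
  obtain ⟨k, hk, hk'⟩ := exists_linked_of_cut hn hT hle U (p := (j, 4)) (q := (i, 4))
    (by simpa [hUj] using h4') (by simpa [hUi] using h4) (by
      intro k u hu w hw h
      by_cases hki : k = i
      · subst hki
        rw [hUi] at hu hw
        exact hS w (not_not.1 hw) u hu h.symm
      by_cases hkj : k = j
      · subst hkj
        rw [hUj] at hu hw
        exact hS' u hu w hw h
      simp only [U, hki, hkj, if_false, Set.mem_ofPred_eq] at hu hw
      exact hw hu)
  have hval0 : ∀ m : ZMod n, m ≠ i → 0 < (m - i).val := fun m hm =>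
    ZMod.val_pos.2 (sub_ne_zero.2 hm)
  have hinj : ∀ m : ZMod n, m ≠ j → (m - i).val ≠ (j - i).val := fun m hm h =>
    hm (sub_left_injective (ZMod.val_injective n h))
  have hsucc : k + 1 ≠ i → (k + 1 - i).val = (k - i).val + 1 := by
    intro h
    have h1 : k + 1 - i = (k - i) + 1 := by ring
    rw [h1, ZMod.val_add_of_lt, ZMod.val_one]
    rw [ZMod.val_one]
    by_contra hlt
    have h2 := ZMod.val_lt (k - i)
    have h3 : (k - i).val + 1 = n := by omega
    apply h
    rw [← sub_eq_zero, h1, ← ZMod.natCast_zmod_val (k - i)]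
    exact_mod_cast (by rw [h3]; simp : (((k - i).val + 1 : ℕ) : ZMod n) = 0)
  have hmem5 : 5 ∈ U k ↔ (k - i).val < (j - i).val := by
    by_cases hki : k = i
    · subst hki
      have := hval0 j (Ne.symm hij)
      simp only [hUi, Set.mem_compl_iff, sub_self, ZMod.val_zero, this, iff_true]
      exact fun h => h5 h hk
    by_cases hkj : k = j
    · subst hkj
      simp only [hUj, lt_irrefl, iff_false]
      exact fun h => h5' h hk
    simp [U, hki, hkj]
  have hmem4 : 4 ∈ U (k + 1) ↔ (k - i).val < (j - i).val := by
    by_cases hki : k + 1 = i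
    · have hk1 : (k - i).val + 1 = n := by
        have h1 : k - i = -1 := by rw [← hki]; ring
        obtain ⟨m, rfl⟩ : ∃ m, n = m + 1 := ⟨n - 1, by omega⟩
        rw [h1, ZMod.val_neg_one]
      have := ZMod.val_lt (j - i)
      rw [hki, hUi]
      simp only [Set.mem_compl_iff, h4, not_true, false_iff]
      omega
    have hs := hsucc hki
    by_cases hkj : k + 1 = j
    · rw [hkj] at hs
      rw [hkj, hUj]
      simp only [h4', true_iff]
      omega
    have := hinj _ hkj
    simp only [U, hki, hkj, if_false, Set.mem_ofPred_eq]
    omega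
  exact hk' (hmem5.trans hmem4.symm)

lemma BlockSplit.linked (hn : 2 ≤ n) (hT : T.Connected) (hle : T ≤ Hgraph n) {i : ZMod n}
    (hi : BlockSplit T i) : Linked T i := by
  have : Fact (1 < n) := ⟨hn⟩
  obtain ⟨S, h4, h5, hS⟩ := hi
  obtain ⟨k, hk, hne⟩ := exists_linked_of_cut hn hT hle (fun k => if k = i then Sᶜ else ∅)
    (p := (i, 5)) (q := (i, 4)) (by simpa using h5) (by simpa using h4) (by
      intro k u hu w hw h
      by_cases hki : k = i
      · subst hki
        simp only [if_true] at hu hw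
        exact hS w (not_not.1 hw) u hu h.symm
      · simp [hki] at hu)
  by_cases hki : k = i
  · exact hki ▸ hk
  · by_cases hki' : k + 1 = i <;> simp [hki, hki', h4] at hne

/-- Two distinct neighbours. -/
def Internal (T : SimpleGraph (ZMod n × Fin 6)) (v : ZMod n × Fin 6) : Prop :=
  ∃ w w', w ≠ w' ∧ T.Adj v w ∧ T.Adj v w'

lemma blockAdj_of_adj (hn : 2 ≤ n) (hle : T ≤ Hgraph n) {i : ZMod n} {u w : Fin 6}
    (h : T.Adj (i, u) (i, w)) : BlockAdj u w := by
  have : Fact (1 < n) := ⟨hn⟩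
  simpa using (adj_iff hn).1 (hle h)

lemma exists_adj_of_not_blockSplit {i : ZMod n} (hi : ¬ BlockSplit T i) (S : Set (Fin 6))
    (h4 : 4 ∈ S) (h5 : 5 ∉ S) : ∃ u ∈ S, ∃ w ∉ S, T.Adj (i, u) (i, w) := by
  by_contra! h
  exact hi ⟨S, h4, h5, h⟩

/-- A nonempty set of the middle vertices of a block has an edge to the rest of the block. -/
lemma exists_adj_of_middle (hn : 2 ≤ n) (hT : T.Connected) (hle : T ≤ Hgraph n) (i : ZMod n)
    (S : Set (Fin 6)) (h4 : 4 ∉ S) (h5 : 5 ∉ S) {p : Fin 6} (hp : p ∈ S) :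
    ∃ u ∈ S, ∃ w ∉ S, T.Adj (i, u) (i, w) := by
  by_contra! h
  obtain ⟨k, -, hk⟩ := exists_linked_of_cut hn hT hle (fun k => if k = i then S else ∅)
    (p := (i, p)) (q := (i, 4)) (by simpa using hp) (by simpa using h4) (by
      intro k u hu w hw
      by_cases hki : k = i
      · subst hki
        simp only [if_true] at hu hw
        exact h u hu w hw
      · simp [hki] at hu)
  by_cases hki : k = i <;> by_cases hki' : k + 1 = i <;> simp_all

lemma internal_of_linked_right {i : ZMod n} {u w : Fin 6} (h : Linked T i) (hn : 2 ≤ n)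
    (hu : u = 5) (hw : T.Adj (i, u) (i, w)) : Internal T (i, 5) := by
  have : Fact (1 < n) := ⟨hn⟩
  subst hu
  exact ⟨_, _, by simp, h, hw⟩

lemma internal_of_linked_left {i : ZMod n} {u w : Fin 6} (h : Linked T (i - 1)) (hn : 2 ≤ n)
    (hu : u = 4) (hw : T.Adj (i, u) (i, w)) : Internal T (i, 4) := by
  have : Fact (1 < n) := ⟨hn⟩
  subst hu
  have h' : T.Adj (i - 1, 5) (i, 4) := by simpa [Linked] using h
  exact ⟨_, _, by simp, h'.symm, hw⟩

lemma internal_left_middle (hn : 2 ≤ n) (hle : T ≤ Hgraph n) {i : ZMod n}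
    (hi : ¬ BlockSplit T i) : Internal T (i, 0) ∨ Internal T (i, 1) := by
  obtain ⟨u, hu, w, hw, h⟩ := exists_adj_of_not_blockSplit hi
    {u | u = 4 ∨ T.Adj (i, 4) (i, u)} (Or.inl rfl) (by
      rintro (h | h)
      · exact absurd h (by decide)
      · exact absurd (blockAdj_of_adj hn hle h) (by decide))
  simp only [Set.mem_ofPred_eq, not_or] at hu hw
  rcases hu with rfl | hu
  · exact absurd h hw.2
  have hI : Internal T (i, u) := ⟨(i, 4), (i, w), by simpa using Ne.symm hw.1, hu.symm, h⟩
  have : u = 0 ∨ u = 1 := by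
    have := blockAdj_of_adj hn hle hu
    revert this; clear * -; revert u; decide
  rcases this with rfl | rfl <;> simp [hI]

lemma internal_right_middle (hn : 2 ≤ n) (hle : T ≤ Hgraph n) {i : ZMod n}
    (hi : ¬ BlockSplit T i) : Internal T (i, 2) ∨ Internal T (i, 3) := by
  obtain ⟨u, hu, w, hw, h⟩ := exists_adj_of_not_blockSplit hi
    {u | ¬ (u = 5 ∨ T.Adj (i, 5) (i, u))} (by
      rintro (h | h)
      · exact absurd h (by decide)
      · exact absurd (blockAdj_of_adj hn hle h) (by decide)) (by simp)
  simp only [Set.mem_ofPred_eq, not_or, not_and, not_not] at hu hw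
  by_cases hw5 : w = 5
  · subst hw5
    exact absurd h.symm hu.2
  have hI : Internal T (i, w) :=
    ⟨(i, 5), (i, u), by simpa using Ne.symm hu.1, (hw hw5).symm, h.symm⟩
  have : w = 2 ∨ w = 3 := by
    have := blockAdj_of_adj hn hle (hw hw5)
    revert this; clear * -; revert w; decide
  rcases this with rfl | rfl <;> simp [hI]

/-- If one end `e` of a block has no neighbour in the block, then the other end `f` has one, and
some middle vertex is internal. -/
lemma internal_of_end_isolated (hn : 2 ≤ n) (hT : T.Connected) (hle : T ≤ Hgraph n) (i : ZMod n)
    {e f : Fin 6} (hef : (e = 4 ∧ f = 5) ∨ (e = 5 ∧ f = 4)) (he : ∀ w, ¬ T.Adj (i, e) (i, w)) :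
    (∃ w, T.Adj (i, f) (i, w)) ∧ ∃ u, u ≠ 4 ∧ u ≠ 5 ∧ Internal T (i, u) := by
  have hcase : ∀ w : Fin 6, w ≠ e → w ≠ f → w ≠ 4 ∧ w ≠ 5 := by
    rcases hef with ⟨rfl, rfl⟩ | ⟨rfl, rfl⟩ <;> decide
  constructor
  · obtain ⟨u, hu, w, hw, h⟩ := exists_adj_of_middle hn hT hle i {u | u ≠ 4 ∧ u ≠ 5}
      (by simp) (by simp) (p := 0) (by simp)
    by_cases hwe : w = e
    · subst hwe
      exact absurd h.symm (he u)
    by_cases hwf : w = f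
    · subst hwf
      exact ⟨u, h.symm⟩
    exact absurd (hcase w hwe hwf) hw
  · obtain ⟨p, hp4, hp5, hpf⟩ : ∃ p : Fin 6, p ≠ 4 ∧ p ≠ 5 ∧ ¬ T.Adj (i, f) (i, p) := by
      rcases hef with ⟨rfl, rfl⟩ | ⟨rfl, rfl⟩
      · exact ⟨0, by decide, by decide, fun h =>
          absurd (blockAdj_of_adj hn hle h) (by decide)⟩
      · exact ⟨2, by decide, by decide, fun h =>
          absurd (blockAdj_of_adj hn hle h) (by decide)⟩
    obtain ⟨u, ⟨hu4, hu5, huf⟩, w, hw, h⟩ := exists_adj_of_middle hn hT hle i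
      {u | u ≠ 4 ∧ u ≠ 5 ∧ ¬ T.Adj (i, f) (i, u)} (by simp) (by simp) (p := p) ⟨hp4, hp5, hpf⟩
    have hwe : w ≠ e := by
      rintro rfl
      exact he u h.symm
    have hwf : w ≠ f := by
      rintro rfl
      exact huf h.symm
    obtain ⟨hw4, hw5⟩ := hcase w hwe hwf
    have hfw : T.Adj (i, f) (i, w) := by
      by_contra hfw
      exact hw ⟨hw4, hw5, hfw⟩
    refine ⟨w, hw4, hw5, (i, f), (i, u), ?_, hfw.symm, h.symm⟩
    rcases hef with ⟨rfl, rfl⟩ | ⟨rfl, rfl⟩ <;> simp [Ne.symm hu4, Ne.symm hu5]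

variable [NeZero n]

/-- The number of leaves of `T` in block `i`. -/
noncomputable def blockLeaves (T : SimpleGraph (ZMod n × Fin 6)) (i : ZMod n) : ℕ :=
  ∑ u : Fin 6, if T.degree (i, u) = 1 then 1 else 0

lemma leafCount_eq_sum (T : SimpleGraph (ZMod n × Fin 6)) :
    leafCount T = ∑ i, blockLeaves T i := by
  unfold leafCount blockLeaves
  rw [Fintype.card_subtype, Finset.card_filter, Fintype.sum_prod_type]

lemma Internal.not_leaf {v : ZMod n × Fin 6} (h : Internal T v) :
    (if T.degree v = 1 then 1 else 0 : ℕ) = 0 := by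
  obtain ⟨w, w', hne, hw, hw'⟩ := h
  exact if_neg (SimpleGraph.degree_ne_one_of_adj_of_adj hne hw hw')

lemma blockLeaves_le (hn : 2 ≤ n) (hT : T.Connected) (hle : T ≤ Hgraph n) (i : ZMod n) :
    blockLeaves T i ≤ 2 + 2 * (if BlockSplit T i then 1 else 0) +
      (if Linked T i then 0 else 1) + (if Linked T (i - 1) then 0 else 1) := by
  have : Fact (1 < n) := ⟨hn⟩
  have hle1 : ∀ v, (if T.degree v = 1 then 1 else 0 : ℕ) ≤ 1 := fun v => by split_ifs <;> simp
  have b0 := hle1 (i, 0)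
  have b1 := hle1 (i, 1)
  have b2 := hle1 (i, 2)
  have b3 := hle1 (i, 3)
  have b4 := hle1 (i, 4)
  have b5 := hle1 (i, 5)
  rw [blockLeaves, Fin.sum_univ_six]
  by_cases hs : BlockSplit T i
  · have hl := hs.linked hn hT hle
    have hl' : Linked T (i - 1) := by
      by_contra hl'
      exact one_ne_zero (sub_eq_self.1 (eq_of_broken hn hT hle (Or.inl hs) (Or.inr hl')).symm)
    simp only [hs, hl, hl', if_true]
    have key : ∀ u, u ≠ 4 → u ≠ 5 → Internal T (i, u) → Internal T (i, 0) ∨ Internal T (i, 1) ∨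
        Internal T (i, 2) ∨ Internal T (i, 3) := by
      intro u h4 h5 h
      fin_cases u <;> simp_all
    by_cases h4 : ∃ w, T.Adj (i, 4) (i, w)
    · obtain ⟨w, hw⟩ := h4
      have := (internal_of_linked_left hl' hn rfl hw).not_leaf
      by_cases h5 : ∃ w, T.Adj (i, 5) (i, w)
      · obtain ⟨w, hw⟩ := h5
        have := (internal_of_linked_right hl hn rfl hw).not_leaf
        omega
      · push Not at h5
        obtain ⟨-, u, hu4, hu5, hu⟩ :=
          internal_of_end_isolated hn hT hle i (Or.inr ⟨rfl, rfl⟩) h5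
        rcases key u hu4 hu5 hu with h | h | h | h <;> have := h.not_leaf <;> omega
    · push Not at h4
      obtain ⟨⟨w, hw⟩, u, hu4, hu5, hu⟩ :=
        internal_of_end_isolated hn hT hle i (Or.inl ⟨rfl, rfl⟩) h4
      have := (internal_of_linked_right hl hn rfl hw).not_leaf
      rcases key u hu4 hu5 hu with h | h | h | h <;> have := h.not_leaf <;> omega
  · have hx : (if T.degree (i, 0) = 1 then 1 else 0 : ℕ) + (if T.degree (i, 1) = 1 then 1 else 0)
        ≤ 1 := by
      rcases internal_left_middle hn hle hs with h | h <;> have := h.not_leaf <;> omega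
    have hz : (if T.degree (i, 2) = 1 then 1 else 0 : ℕ) + (if T.degree (i, 3) = 1 then 1 else 0)
        ≤ 1 := by
      rcases internal_right_middle hn hle hs with h | h <;> have := h.not_leaf <;> omega
    have ha : (if T.degree (i, 4) = 1 then 1 else 0 : ℕ) ≤ if Linked T (i - 1) then 0 else 1 := by
      split_ifs with _ hl
      · obtain ⟨u, hu, w, -, h⟩ := exists_adj_of_not_blockSplit hs {4} rfl (by simp)
        have := (internal_of_linked_left hl hn hu h).not_leaf
        simp_all
      all_goals simp
    have hb : (if T.degree (i, 5) = 1 then 1 else 0 : ℕ) ≤ if Linked T i then 0 else 1 := by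
      split_ifs with _ hl
      · obtain ⟨u, -, w, hw, h⟩ := exists_adj_of_not_blockSplit hs {5}ᶜ (by simp) (by simp)
        have := (internal_of_linked_right hl hn (not_not.1 hw) h.symm).not_leaf
        simp_all
      all_goals simp
    simp only [hs, if_false]
    omega

theorem leafCount_le (hn : 2 ≤ n) (hT : T.Connected) (hle : T ≤ Hgraph n) :
    leafCount T ≤ 2 * n + 2 := by
  have hbroken : ∑ i, (if Broken T i then 1 else 0 : ℕ) ≤ 1 := by
    rw [← Finset.card_filter, Finset.card_le_one]
    intro i hi j hj
    exact eq_of_broken hn hT hle (Finset.mem_filter.1 hi).2 (Finset.mem_filter.1 hj).2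
  have hsum : ∑ i, ((if BlockSplit T i then 1 else 0) + if Linked T i then 0 else 1 : ℕ) ≤ 1 := by
    refine (Finset.sum_le_sum fun i _ => ?_).trans hbroken
    by_cases hs : BlockSplit T i
    · simp [Broken, hs, hs.linked hn hT hle]
    · by_cases hl : Linked T i <;> simp [Broken, hs, hl]
  have hshift : ∑ i, (if Linked T (i - 1) then 0 else 1 : ℕ) = ∑ i, if Linked T i then 0 else 1 :=
    (Equiv.subRight (1 : ZMod n)).sum_comp fun i => if Linked T i then 0 else 1
  have htotal := Finset.sum_le_sum fun i (_ : i ∈ Finset.univ) => blockLeaves_le hn hT hle i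
  rw [← leafCount_eq_sum] at htotal
  simp only [Finset.sum_add_distrib, ← Finset.mul_sum, hshift, Finset.sum_const, Finset.card_univ,
    ZMod.card, smul_eq_mul] at htotal hsum
  omega

end UpperBound

section Extremal

/-- A connected spanning subgraph of `H_n` with `2n + 2` leaves: all links, all edges at
the `a_i` and `b_i`, and the edges `x_i z_i` for `i ≠ 0`. -/
def extremal (n : ℕ) : SimpleGraph (ZMod n × Fin 6) :=
  SimpleGraph.fromRel fun u v =>
    (u.1 = v.1 ∧ ((u.2 = 4 ∧ v.2 = 0) ∨ (u.2 = 4 ∧ v.2 = 1) ∨ (u.2 = 5 ∧ v.2 = 2) ∨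
      (u.2 = 5 ∧ v.2 = 3) ∨ (u.1 ≠ 0 ∧ u.2 = 0 ∧ v.2 = 2))) ∨
    (v.1 = u.1 + 1 ∧ u.2 = 5 ∧ v.2 = 4)

lemma extremal_le : extremal n ≤ Hgraph n := by
  rintro ⟨i, u⟩ ⟨j, w⟩ h
  simp only [extremal, Hgraph, SimpleGraph.fromRel_adj] at h ⊢
  refine ⟨h.1, h.2.imp ?_ ?_⟩
  all_goals
    rintro (⟨h, h'⟩ | ⟨h', rfl, rfl⟩)
    · refine Or.inl ⟨h, ?_⟩
      rcases h' with ⟨rfl, rfl⟩ | ⟨rfl, rfl⟩ | ⟨rfl, rfl⟩ | ⟨rfl, rfl⟩ | ⟨-, rfl, rfl⟩ <;> decide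
    · exact Or.inr ⟨h', rfl, rfl⟩

lemma extremal_connected [NeZero n] : (extremal n).Connected := by
  have hax : ∀ i, (extremal n).Adj (i, 4) (i, 0) := by simp [extremal]
  have hay : ∀ i, (extremal n).Adj (i, 4) (i, 1) := by simp [extremal]
  have hbz : ∀ i, (extremal n).Adj (i, 5) (i, 2) := by simp [extremal]
  have hbv : ∀ i, (extremal n).Adj (i, 5) (i, 3) := by simp [extremal]
  have hxz : ∀ i, i ≠ 0 → (extremal n).Adj (i, 0) (i, 2) := by simp +contextual [extremal]
  have hba : ∀ i, (extremal n).Adj (i, 5) (i + 1, 4) := by simp [extremal]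
  have hbk : ∀ k : ℕ, (extremal n).Reachable (0, 5) ((k : ZMod n), 5) := by
    intro k
    induction k with
    | zero => simp
    | succ k ih =>
      by_cases h0 : ((k + 1 : ℕ) : ZMod n) = 0
      · rw [h0]
      · push_cast at h0 ⊢
        exact ih.trans <| (hba _).reachable.trans <| (hax _).reachable.trans <|
          (hxz _ h0).reachable.trans (hbz _).reachable.symm
  have hb : ∀ i, (extremal n).Reachable (0, 5) (i, 5) := fun i => by
    simpa using hbk i.val
  have ha : ∀ i, (extremal n).Reachable (0, 5) (i, 4) := fun i => by
    simpa using (hb (i - 1)).trans (hba (i - 1)).reachable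
  refine SimpleGraph.connected_iff_exists_forall_reachable _ |>.2 ⟨(0, 5), ?_⟩
  rintro ⟨i, u⟩
  fin_cases u
  · exact (ha i).trans (hax i).reachable
  · exact (ha i).trans (hay i).reachable
  · exact (hb i).trans (hbz i).reachable
  · exact (hb i).trans (hbv i).reachable
  · exact ha i
  · exact hb i

/-- Vertices with a single neighbour in the extremal subgraph. -/
def extremalLeaves (n : ℕ) [NeZero n] : Finset (ZMod n × Fin 6) :=
  Finset.univ ×ˢ {1, 3} ∪ {0} ×ˢ {0, 2}

lemma card_extremalLeaves [NeZero n] : (extremalLeaves n).card = 2 * n + 2 := by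
  rw [extremalLeaves, Finset.card_union_of_disjoint]
  · simp [Finset.card_product, ZMod.card, mul_comm]
  · rw [Finset.disjoint_left]
    rintro ⟨i, u⟩ h h'
    simp only [Finset.mem_product, Finset.mem_insert, Finset.mem_singleton] at h h'
    omega

lemma extremal_neighbor_unique [NeZero n] {v w w' : ZMod n × Fin 6} (hv : v ∈ extremalLeaves n)
    (h : (extremal n).Adj v w) (h' : (extremal n).Adj v w') : w = w' := by
  obtain ⟨i, u⟩ := v
  obtain ⟨j, w⟩ := w
  obtain ⟨j', w'⟩ := w'
  simp only [extremalLeaves, Finset.mem_union, Finset.mem_product, Finset.mem_univ, true_and,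
    Finset.mem_insert, Finset.mem_singleton] at hv
  simp only [extremal, SimpleGraph.fromRel_adj] at h h'
  rcases hv with (rfl | rfl) | ⟨rfl, rfl | rfl⟩ <;> simp at h h' <;> grind

theorem exists_isTree_leafCount_eq [NeZero n] (hn : 2 ≤ n) :
    ∃ T ≤ Hgraph n, T.IsTree ∧ leafCount T = 2 * n + 2 := by
  have : Fact (1 < n) := ⟨hn⟩
  obtain ⟨T, hle, hT⟩ := extremal_connected (n := n) |>.exists_isTree_le
  refine ⟨T, hle.trans extremal_le, hT, le_antisymm
    (leafCount_le hn hT.connected (hle.trans extremal_le)) ?_⟩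
  rw [← card_extremalLeaves, leafCount, Fintype.card_subtype]
  refine Finset.card_le_card fun v hv => Finset.mem_filter.2 ⟨Finset.mem_univ _, ?_⟩
  rw [SimpleGraph.degree_eq_one_iff_existsUnique_adj]
  obtain ⟨w, hw⟩ := hT.connected.preconnected.exists_adj_of_nontrivial v
  exact ⟨w, hw, fun w' hw' => extremal_neighbor_unique hv (hle hw') (hle hw)⟩

end Extremal

section Degrees

variable [NeZero n]

lemma degree_eq (hn : 2 ≤ n) (i : ZMod n) (u : Fin 6) :
    (Hgraph n).degree (i, u) = if u.val < 4 then 4 else 3 := by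
  have : Fact (1 < n) := ⟨hn⟩
  have hset : ∀ S : Finset (ZMod n × Fin 6), (∀ w, (Hgraph n).Adj (i, u) w ↔ w ∈ S) →
      (Hgraph n).degree (i, u) = S.card := by
    intro S hS
    rw [← SimpleGraph.card_neighborFinset_eq_degree]
    congr 1
    ext w
    rw [SimpleGraph.mem_neighborFinset, hS]
  have hsucc : ∀ j : ZMod n, i = j + 1 ↔ j = i - 1 := fun j => by
    rw [eq_sub_iff_add_eq, eq_comm]
  have hmid : ∀ N : Finset (Fin 6), u ≠ 4 → u ≠ 5 → (∀ w, BlockAdj u w ↔ w ∈ N) →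
      (Hgraph n).degree (i, u) = N.card := by
    intro N h4 h5 hN
    rw [hset ({i} ×ˢ N) fun ⟨j, w⟩ => by simp [adj_iff hn, h4, h5, hN, eq_comm, and_comm]]
    simp
  fin_cases u
  · exact hmid {1, 2, 3, 4} (by decide) (by decide) (by decide)
  · exact hmid {0, 2, 3, 4} (by decide) (by decide) (by decide)
  · exact hmid {0, 1, 3, 5} (by decide) (by decide) (by decide)
  · exact hmid {0, 1, 2, 5} (by decide) (by decide) (by decide)
  · have hN : ∀ w, BlockAdj 4 w ↔ w = 0 ∨ w = 1 := by decide
    refine (hset {(i, 0), (i, 1), (i - 1, 5)} fun ⟨j, w⟩ => ?_).trans ?_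
    · simp [adj_iff hn, hN, hsucc, eq_comm (a := i)]
      tauto
    · rw [Finset.card_eq_three.2 ⟨_, _, _, ?_, ?_, ?_, rfl⟩] <;> simp
  · have hN : ∀ w, BlockAdj 5 w ↔ w = 2 ∨ w = 3 := by decide
    refine (hset {(i, 2), (i, 3), (i + 1, 4)} fun ⟨j, w⟩ => ?_).trans ?_
    · simp [adj_iff hn, hN, eq_comm (a := i)]
      tauto
    · rw [Finset.card_eq_three.2 ⟨_, _, _, ?_, ?_, ?_, rfl⟩] <;> simp

lemma card_degree_eq (hn : 2 ≤ n) (d : ℕ) (N : Finset (Fin 6))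
    (hN : ∀ u : Fin 6, (if u.val < 4 then 4 else 3) = d ↔ u ∈ N) :
    Fintype.card {v : ZMod n × Fin 6 // (Hgraph n).degree v = d} = N.card * n := by
  rw [Fintype.card_subtype]
  have : Finset.univ.filter (fun v : ZMod n × Fin 6 => (Hgraph n).degree v = d) =
      Finset.univ ×ˢ N := by
    ext ⟨i, u⟩
    simp [degree_eq hn, hN]
  rw [this, Finset.card_product, Finset.card_univ, ZMod.card, mul_comm]

end Degrees

end Hgraph

/-- For every `n ≥ 2` the graph `H_n` is connected, has exactly `2n` vertices of
degree 3 and exactly `4n` vertices of degree 4, and the maximum number of leaves of a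
spanning tree of `H_n` equals `2n + 2 = (2/5)·(4n) + (1/5)·(2n) + 2`. -/
theorem Hgraph_extremal (n : ℕ) [NeZero n] (hn : 2 ≤ n) :
    (Hgraph n).Connected ∧
    Fintype.card {v : ZMod n × Fin 6 // (Hgraph n).degree v = 3} = 2 * n ∧
    Fintype.card {v : ZMod n × Fin 6 // (Hgraph n).degree v = 4} = 4 * n ∧
    (∃ T ≤ Hgraph n, T.IsTree ∧ leafCount T = 2 * n + 2) ∧
    (∀ T ≤ Hgraph n, T.IsTree → leafCount T ≤ 2 * n + 2) := by
  exact ⟨Hgraph.extremal_connected.mono Hgraph.extremal_le,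
    Hgraph.card_degree_eq hn 3 {4, 5} (by decide),
    Hgraph.card_degree_eq hn 4 {0, 1, 2, 3} (by decide),
    Hgraph.exists_isTree_leafCount_eq hn, fun _ hle hT => Hgraph.leafCount_le hn hT.connected hle⟩
end

section
/- For every integer n ≥ 21, the graph H_n is a connected graph all of whose vertices have degree 3 or 4, and the maximum number of leaves of a spanning tree of H_n, which equals 2n + 2, is strictly less than Σ_{x ∈ V(H_n)} (d(x) − 2)/(d(x) + 1) = 21n/10. Hence the strong Linial conjecture, asserting that every connected graph G with minimum degree at least 2 has a spanning tree with at least Σ_{x ∈ V(G)} (d_G(x) − 2)/(d_G(x) + 1) leaves, is false already for graphs with all degrees equal to 3 or 4. -/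
open scoped Classical

section Cuts

variable {V : Type*} {T : SimpleGraph V}

theorem SimpleGraph.Connected.exists_adj_cut (hT : T.Connected) (S : V → Prop) {u w : V}
    (hu : S u) (hw : ¬ S w) : ∃ p q, S p ∧ ¬ S q ∧ T.Adj p q := by
  obtain ⟨W⟩ := hT.preconnected u w
  obtain ⟨d, -, h1, h2⟩ := W.exists_boundary_dart {x | S x} hu hw
  exact ⟨_, _, h1, h2, d.adj⟩

variable [Fintype V]

theorem SimpleGraph.Connected.exists_adj_nonleaf (hT : T.Connected) (hV : 2 < Fintype.card V)
    {u : V} (hu : T.degree u = 1) : ∃ w, T.degree w ≠ 1 ∧ T.Adj u w := by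
  have : Nontrivial V := Fintype.one_lt_card_iff_nontrivial.mp (by omega)
  obtain ⟨w, hw⟩ := hT.preconnected.exists_adj_of_nontrivial u
  by_contra! h
  have hlw : T.degree w = 1 := by
    by_contra h1
    exact h w h1 hw
  obtain ⟨x, hx⟩ : ∃ x, ¬ (x = u ∨ x = w) := by
    by_contra! hc
    have h3 : (Finset.univ : Finset V) ⊆ {u, w} := fun x _ => by simpa using hc x
    have h4 := (Finset.card_le_card h3).trans Finset.card_le_two
    rw [Finset.card_univ] at h4
    omega
  obtain ⟨p, q, hp, hq, hpq⟩ := hT.exists_adj_cut (fun x => x = u ∨ x = w) (Or.inl rfl) hx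
  rw [SimpleGraph.degree_eq_one_iff_existsUnique_adj] at hlw hu
  rcases hp with rfl | rfl
  · exact hq (Or.inr (hu.unique hpq hw))
  · exact hq (Or.inl (hlw.unique hpq hw.symm))

theorem SimpleGraph.Connected.exists_adj_cut_nonleaf (hT : T.Connected) (S : V → Prop) {u w : V}
    (hu : S u) (hu1 : T.degree u ≠ 1) (hw : ¬ S w) (hw1 : T.degree w ≠ 1) :
    ∃ p q, T.degree p ≠ 1 ∧ S p ∧ T.degree q ≠ 1 ∧ ¬ S q ∧ T.Adj p q := by
  obtain ⟨p, q, hp, hq, hpq⟩ := hT.exists_adj_cut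
    (fun x => T.degree x ≠ 1 ∧ S x ∨ T.degree x = 1 ∧ ∃ y, T.Adj x y ∧ T.degree y ≠ 1 ∧ S y)
    (Or.inl ⟨hu1, hu⟩) (w := w) (by tauto)
  rcases hp with hp | ⟨hp, y, hy, hy1⟩
  · by_cases hq1 : T.degree q = 1
    · exact absurd (Or.inr ⟨hq1, p, hpq.symm, hp⟩) hq
    · exact ⟨p, q, hp.1, hp.2, hq1, by tauto, hpq⟩
  · rw [SimpleGraph.degree_eq_one_iff_existsUnique_adj] at hp
    obtain rfl := hp.unique hpq hy
    exact absurd (Or.inl hy1) hq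

end Cuts

/-- The adjacency relation inside a block of `Hgraph`. -/
def blockAdj (c d : Fin 6) : Prop :=
  c ≠ d ∧ (c.val < 4 ∧ d.val < 4 ∨
    c = 4 ∧ d.val < 2 ∨ d = 4 ∧ c.val < 2 ∨
    c = 5 ∧ (d = 2 ∨ d = 3) ∨ d = 5 ∧ (c = 2 ∨ c = 3))

theorem Hgraph_adj_iff {n : ℕ} {i j : ZMod n} {c d : Fin 6} :
    (Hgraph n).Adj (i, c) (j, d) ↔
      i = j ∧ blockAdj c d ∨ j = i + 1 ∧ c = 5 ∧ d = 4 ∨ i = j + 1 ∧ c = 4 ∧ d = 5 := by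
  simp only [Hgraph, SimpleGraph.fromRel_adj, blockAdj, eq_comm (a := j) (b := i)]
  by_cases hij : i = j
  · subst hij
    fin_cases c <;> fin_cases d <;> simp
  · fin_cases c <;> fin_cases d <;> simp [hij]

theorem Hgraph_degree {n : ℕ} [NeZero n] (i : ZMod n) (c : Fin 6) :
    (Hgraph n).degree (i, c) = if c.val < 4 then 4 else 3 := by
  have key (s : Finset (ZMod n × Fin 6)) (h : ∀ j d, (Hgraph n).Adj (i, c) (j, d) ↔ (j, d) ∈ s) :
      (Hgraph n).degree (i, c) = s.card := by
    rw [← SimpleGraph.card_neighborFinset_eq_degree]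
    congr 1
    ext ⟨j, d⟩
    rw [SimpleGraph.mem_neighborFinset, h]
  fin_cases c
  · rw [key {(i, 1), (i, 2), (i, 3), (i, 4)}]
    · simp
    · intro j d; rw [Hgraph_adj_iff]; fin_cases d <;> simp [blockAdj, eq_comm]
  · rw [key {(i, 0), (i, 2), (i, 3), (i, 4)}]
    · simp
    · intro j d; rw [Hgraph_adj_iff]; fin_cases d <;> simp [blockAdj, eq_comm]
  · rw [key {(i, 0), (i, 1), (i, 3), (i, 5)}]
    · simp
    · intro j d; rw [Hgraph_adj_iff]; fin_cases d <;> simp [blockAdj, eq_comm]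
  · rw [key {(i, 0), (i, 1), (i, 2), (i, 5)}]
    · simp
    · intro j d; rw [Hgraph_adj_iff]; fin_cases d <;> simp [blockAdj, eq_comm]
  · rw [key {(i, 0), (i, 1), (i - 1, 5)}]
    · simp
    · intro j d; rw [Hgraph_adj_iff]
      fin_cases d <;> simp [blockAdj, eq_comm, eq_sub_iff_add_eq]
  · rw [key {(i, 2), (i, 3), (i + 1, 4)}]
    · simp
    · intro j d; rw [Hgraph_adj_iff]; fin_cases d <;> simp [blockAdj, eq_comm]

theorem sum_Hgraph_degree {n : ℕ} [NeZero n] :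
    ∑ v : ZMod n × Fin 6,
        (((Hgraph n).degree v : ℚ) - 2) / (((Hgraph n).degree v : ℚ) + 1) = 21 * n / 10 := by
  rw [Fintype.sum_prod_type]
  simp only [Hgraph_degree, Fin.sum_univ_six]
  norm_num [ZMod.card]
  ring

theorem ZMod.val_add_one_eq_ite {n : ℕ} [NeZero n] (hn : 1 < n) (t : ZMod n) :
    (t + 1).val = if t + 1 = 0 then 0 else t.val + 1 := by
  have : Fact (1 < n) := ⟨hn⟩
  have h := ZMod.val_add t 1
  rw [ZMod.val_one] at h
  have ht := t.val_lt
  split_ifs with h0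
  · simp [h0]
  · rw [h, Nat.mod_eq_of_lt]
    by_contra hc
    have h1 : t.val + 1 = n := by omega
    rw [h1, Nat.mod_self, ZMod.val_eq_zero] at h
    exact h0 h

section ConnectedDominating

variable {n : ℕ} (D : ZMod n × Fin 6 → Prop)

/-- `D` is a dominating set of `Hgraph n` that cannot be split by a vertex cut. -/
structure ConnectedDominating : Prop where
  dom : ∀ u, ¬ D u → ∃ w, D w ∧ (Hgraph n).Adj u w
  cut : ∀ (S : ZMod n × Fin 6 → Prop) (u w : ZMod n × Fin 6), D u → S u → D w → ¬ S w →
    ∃ p q, D p ∧ S p ∧ D q ∧ ¬ S q ∧ (Hgraph n).Adj p q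

/-- The set `D` contains a path through the `i`-th block, from `a_i` to `b_i`. -/
def FullBlock (i : ZMod n) : Prop :=
  D (i, 4) ∧ D (i, 5) ∧ (D (i, 0) ∨ D (i, 1)) ∧ (D (i, 2) ∨ D (i, 3))

/-- The part of the `i`-th block that `D` attaches to `a_i`. -/
def LeftPart (i : ZMod n) (c : Fin 6) : Prop :=
  c = 4 ∨ D (i, 4) ∧ (D (i, 0) ∨ D (i, 1)) ∧ c ≠ 5

/-- The number of vertices of `D` in the `i`-th block. -/
noncomputable def blockCount (i : ZMod n) : ℕ := ∑ c, if D (i, c) then 1 else 0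

variable {D}

theorem leftPart_iff_of_blockAdj {i : ZMod n} (hi : ¬ FullBlock D i) {c d : Fin 6}
    (hc : D (i, c)) (hd : D (i, d)) (h : blockAdj c d) : LeftPart D i c ↔ LeftPart D i d := by
  simp only [FullBlock, LeftPart, blockAdj] at *
  fin_cases c <;> fin_cases d <;> simp at * <;> tauto

theorem card_le_blockCount {i : ZMod n} (s : Finset (Fin 6)) (hs : ∀ c ∈ s, D (i, c)) :
    s.card ≤ blockCount D i := by
  rw [blockCount, Finset.sum_boole, Nat.cast_id]
  exact Finset.card_le_card fun c hc => by simpa using hs c hc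

theorem four_le_blockCount {i : ZMod n} (hi : FullBlock D i) : 4 ≤ blockCount D i := by
  obtain ⟨h4, h5, h0 | h0, h2 | h2⟩ := hi
  · exact card_le_blockCount {4, 5, 0, 2} (by simp [*])
  · exact card_le_blockCount {4, 5, 0, 3} (by simp [*])
  · exact card_le_blockCount {4, 5, 1, 2} (by simp [*])
  · exact card_le_blockCount {4, 5, 1, 3} (by simp [*])

namespace ConnectedDominating

theorem dom_core (h : ConnectedDominating D) (i : ZMod n) :
    (D (i, 0) ∨ D (i, 1) ∨ D (i, 2) ∨ D (i, 3) ∨ D (i, 4)) ∧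
      (D (i, 0) ∨ D (i, 1) ∨ D (i, 2) ∨ D (i, 3) ∨ D (i, 5)) := by
  constructor
  · by_cases h0 : D (i, 0)
    · exact Or.inl h0
    obtain ⟨⟨j, c⟩, hw, hadj⟩ := h.dom _ h0
    rw [Hgraph_adj_iff] at hadj
    simp [blockAdj] at hadj
    obtain ⟨rfl, hc⟩ := hadj
    fin_cases c <;> simp_all
  · by_cases h0 : D (i, 2)
    · tauto
    obtain ⟨⟨j, c⟩, hw, hadj⟩ := h.dom _ h0
    rw [Hgraph_adj_iff] at hadj
    simp [blockAdj] at hadj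
    obtain ⟨rfl, hc⟩ := hadj
    fin_cases c <;> simp_all

theorem exists_mem_block (h : ConnectedDominating D) (i : ZMod n) : ∃ c, D (i, c) := by
  rcases (h.dom_core i).1 with h | h | h | h | h <;> exact ⟨_, h⟩

theorem core_attached [Nontrivial (ZMod n)] (h : ConnectedDominating D) {i : ZMod n} {c : Fin 6}
    (hc : c.val < 4) (hD : D (i, c)) :
    D (i, 4) ∧ (D (i, 0) ∨ D (i, 1)) ∨ D (i, 5) ∧ (D (i, 2) ∨ D (i, 3)) := by
  obtain ⟨d, hd⟩ := h.exists_mem_block (i + 1)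
  obtain ⟨⟨j, p⟩, ⟨k, q⟩, hp, ⟨rfl, hp4⟩, hq, hS, hadj⟩ :=
    h.cut (fun u => u.1 = i ∧ u.2.val < 4) _ _ hD ⟨rfl, hc⟩ hd (by simp)
  rw [Hgraph_adj_iff] at hadj
  simp only at hp4 hS
  rcases hadj with ⟨rfl, hb⟩ | ⟨-, rfl, -⟩ | ⟨-, rfl, -⟩
  · fin_cases p <;> fin_cases q <;> simp_all [blockAdj]
  · simp at hp4
  · simp at hp4

theorem eq_add_one_or_eq_add_one [NeZero n] (hn : 1 < n) (h : ConnectedDominating D)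
    {i j : ZMod n} (hi : ¬ FullBlock D i) (hj : ¬ FullBlock D j) (hij : i ≠ j) :
    (j = i + 1 ∧ (∀ c, D (i, c) → LeftPart D i c) ∧ ∀ c, D (j, c) → ¬ LeftPart D j c) ∨
      (i = j + 1 ∧ (∀ c, D (j, c) → LeftPart D j c) ∧ ∀ c, D (i, c) → ¬ LeftPart D i c) := by
  have : Fact (1 < n) := ⟨hn⟩
  have hpos : (j - i).val ≠ 0 := by
    rw [Ne, ZMod.val_eq_zero, sub_eq_zero]; exact hij.symm
  have hsucc (k : ZMod n) (hk : k + 1 ≠ i) : (k + 1 - i).val = (k - i).val + 1 := by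
    rw [add_sub_right_comm, ZMod.val_add_one_eq_ite hn, if_neg]
    rwa [← add_sub_right_comm, sub_eq_zero]
  let S : ZMod n × Fin 6 → Prop := fun u =>
    if u.1 = i then ¬ LeftPart D i u.2 else if u.1 = j then LeftPart D j u.2 else
      (u.1 - i).val < (j - i).val
  have hSi (c) : S (i, c) ↔ ¬ LeftPart D i c := by simp [S]
  have hSj (c) : S (j, c) ↔ LeftPart D j c := by simp [S, hij.symm]
  have hSk (k c) (h1 : k ≠ i) (h2 : k ≠ j) : S (k, c) ↔ (k - i).val < (j - i).val := by
    simp [S, h1, h2]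
  have hl4 (k) : LeftPart D k 4 := Or.inl rfl
  have hl5 (k) : ¬ LeftPart D k 5 := by simp [LeftPart]
  have hlink (k : ZMod n) : S (k, 5) ↔ S (k + 1, 4) := by
    by_cases hki : k = i
    · subst hki
      have hk1 : k + 1 ≠ k := by simp
      by_cases hkj : k + 1 = j
      · rw [hkj, hSi, hSj]; simp [hl4, hl5]
      · rw [hSi, hSk _ _ hk1 hkj, hsucc _ hk1]
        have h3 : (j - k).val ≠ 1 := fun h3 => hkj <| by
          have : j - k = 1 := ZMod.val_injective n (by rw [h3, ZMod.val_one])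
          rw [← this]; ring
        simp [hl5]
        omega
    · by_cases hk1 : k + 1 = i
      · rw [hk1, hSi]
        by_cases hkj : k = j
        · rw [hkj, hSj]; simp [hl4, hl5]
        · rw [hSk _ _ hki hkj]
          simp only [hl4, not_true, iff_false, not_lt]
          have h3 : k - i = -1 := by rw [← hk1]; ring
          have h4 : (k - i).val + 1 = n := by
            have h6 := ZMod.val_add (k - i) 1
            rw [ZMod.val_one] at h6
            have h7 : k - i + 1 = 0 := by rw [h3]; ring
            rw [h7, ZMod.val_zero] at h6
            have h8 := Nat.dvd_of_mod_eq_zero h6.symm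
            have h9 := (k - i).val_lt
            exact le_antisymm h9 (Nat.le_of_dvd (by omega) h8)
          have h5 := (j - i).val_lt
          omega
      · by_cases hkj : k = j
        · subst hkj
          rw [hSj, hSk _ _ hk1 (by simp), hsucc _ hk1]
          simp [hl5]
        · rw [hSk _ _ hki hkj]
          by_cases hk1j : k + 1 = j
          · have h3 := hsucc _ hk1
            rw [hk1j] at h3 ⊢
            rw [hSj, h3]
            simp [hl4]
          · rw [hSk _ _ hk1 hk1j, hsucc _ hk1]
            have h3 : (k + 1 - i).val ≠ (j - i).val := fun h3 =>
              hk1j (sub_left_injective (ZMod.val_injective n h3))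
            rw [hsucc _ hk1] at h3
            omega
  have hedge (u w) (hu : D u) (hw : D w) (huw : (Hgraph n).Adj u w) : S u ↔ S w := by
    obtain ⟨k, c⟩ := u
    obtain ⟨l, d⟩ := w
    rw [Hgraph_adj_iff] at huw
    rcases huw with ⟨rfl, hb⟩ | ⟨rfl, rfl, rfl⟩ | ⟨rfl, rfl, rfl⟩
    · by_cases hki : k = i
      · subst hki
        rw [hSi, hSi, leftPart_iff_of_blockAdj hi hu hw hb]
      · by_cases hkj : k = j
        · subst hkj
          rw [hSj, hSj, leftPart_iff_of_blockAdj hj hu hw hb]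
        · rw [hSk _ _ hki hkj, hSk _ _ hki hkj]
    · exact hlink k
    · exact (hlink l).symm
  have hsplit : (∀ u, D u → ¬ S u) ∨ ∀ u, D u → S u := by
    by_contra! hc
    obtain ⟨⟨u, hu, huS⟩, w, hw, hwS⟩ := hc
    obtain ⟨p, q, hp, hpS, hq, hqS, hpq⟩ := h.cut S u w hu huS hw hwS
    exact hqS ((hedge p q hp hq hpq).mp hpS)
  rcases hsplit with hs | hs
  · refine Or.inl ⟨?_, fun c hc => by_contra fun h1 => hs _ hc ((hSi c).mpr h1),
      fun c hc h1 => hs _ hc ((hSj c).mpr h1)⟩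
    by_contra hne
    obtain ⟨c, hc⟩ := h.exists_mem_block (i + 1)
    have hi1 : i + 1 ≠ i := by simp
    have h1 := hs _ hc
    rw [hSk _ _ hi1 (Ne.symm hne), hsucc _ hi1] at h1
    have h3 : (j - i).val ≠ 1 := fun h3 => hne <| by
      have : j - i = 1 := ZMod.val_injective n (by rw [h3, ZMod.val_one])
      rw [← this]; ring
    simp at h1
    omega
  · refine Or.inr ⟨?_, fun c hc => (hSj c).mp (hs _ hc), fun c hc => (hSi c).mp (hs _ hc)⟩
    by_contra hne
    obtain ⟨c, hc⟩ := h.exists_mem_block (j + 1)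
    have h1 := hs _ hc
    rw [hSk _ _ (Ne.symm hne) (by simp), hsucc _ (Ne.symm hne)] at h1
    omega

theorem two_le_blockCount [Nontrivial (ZMod n)] (h : ConnectedDominating D) (i : ZMod n) :
    2 ≤ blockCount D i := by
  have h45 : D (i, 4) ∧ D (i, 5) ∨
      D (i, 4) ∧ (D (i, 0) ∨ D (i, 1)) ∨ D (i, 5) ∧ (D (i, 2) ∨ D (i, 3)) := by
    by_cases hc : ∃ c : Fin 6, c.val < 4 ∧ D (i, c)
    · obtain ⟨c, hc, hD⟩ := hc
      exact Or.inr (h.core_attached hc hD)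
    · push Not at hc
      have h0 := hc 0 (by decide)
      have h1 := hc 1 (by decide)
      have h2 := hc 2 (by decide)
      have h3 := hc 3 (by decide)
      have := h.dom_core i
      tauto
  rcases h45 with ⟨h4, h5⟩ | ⟨h4, h0 | h0⟩ | ⟨h5, h0 | h0⟩
  · exact card_le_blockCount {4, 5} (by simp [*])
  · exact card_le_blockCount {4, 0} (by simp [*])
  · exact card_le_blockCount {4, 1} (by simp [*])
  · exact card_le_blockCount {5, 2} (by simp [*])
  · exact card_le_blockCount {5, 3} (by simp [*])

theorem three_le_blockCount [Nontrivial (ZMod n)] (h : ConnectedDominating D) {i : ZMod n}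
    (hi : ∀ c, D (i, c) → LeftPart D i c)
    (hi' : ∀ c, D (i + 1, c) → ¬ LeftPart D (i + 1) c) :
    3 ≤ blockCount D i ∧ 3 ≤ blockCount D (i + 1) := by
  have h5 : ¬ D (i, 5) := fun h1 => by simpa [LeftPart] using hi _ h1
  have h4 : ¬ D (i + 1, 4) := fun h1 => hi' _ h1 (Or.inl rfl)
  have hb : D (i, 2) ∨ D (i, 3) := by
    obtain ⟨⟨j, c⟩, hw, hadj⟩ := h.dom _ h5
    rw [Hgraph_adj_iff] at hadj
    fin_cases c <;> simp_all [blockAdj]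
  have ha : D (i + 1, 0) ∨ D (i + 1, 1) := by
    obtain ⟨⟨j, c⟩, hw, hadj⟩ := h.dom _ h4
    rw [Hgraph_adj_iff] at hadj
    fin_cases c <;> simp_all [blockAdj]
  constructor
  · have hatt : D (i, 4) ∧ (D (i, 0) ∨ D (i, 1)) := by
      rcases hb with hb | hb
      · exact (h.core_attached (by decide) hb).resolve_right (fun hc => h5 hc.1)
      · exact (h.core_attached (by decide) hb).resolve_right (fun hc => h5 hc.1)
    obtain ⟨h4', h0 | h0⟩ := hatt <;> rcases hb with hb | hb
    · exact card_le_blockCount {4, 0, 2} (by simp [*])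
    · exact card_le_blockCount {4, 0, 3} (by simp [*])
    · exact card_le_blockCount {4, 1, 2} (by simp [*])
    · exact card_le_blockCount {4, 1, 3} (by simp [*])
  · have hatt : D (i + 1, 5) ∧ (D (i + 1, 2) ∨ D (i + 1, 3)) := by
      rcases ha with ha | ha
      · exact (h.core_attached (by decide) ha).resolve_left (fun hc => h4 hc.1)
      · exact (h.core_attached (by decide) ha).resolve_left (fun hc => h4 hc.1)
    obtain ⟨h5', h2 | h2⟩ := hatt <;> rcases ha with ha | ha
    · exact card_le_blockCount {5, 2, 0} (by simp [*])
    · exact card_le_blockCount {5, 2, 1} (by simp [*])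
    · exact card_le_blockCount {5, 3, 0} (by simp [*])
    · exact card_le_blockCount {5, 3, 1} (by simp [*])

theorem le_sum_blockCount [NeZero n] (hn : 3 < n) (h : ConnectedDominating D) :
    4 * n ≤ ∑ i, blockCount D i + 2 := by
  have : Fact (1 < n) := ⟨by omega⟩
  have key (i j : ZMod n) (hij : i ≠ j)
      (hd : ∀ k, 4 ≤ blockCount D k + (if k = i then 1 else 0) + (if k = j then 1 else 0)) :
      4 * n ≤ ∑ i, blockCount D i + 2 := by
    have h1 := Finset.sum_le_sum fun k (_ : k ∈ Finset.univ) => hd k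
    simp only [Finset.sum_add_distrib, Finset.sum_ite_eq', Finset.sum_const, Finset.card_univ,
      ZMod.card, Finset.mem_univ, if_true, smul_eq_mul] at h1
    omega
  by_cases hF : ∃ i, ¬ FullBlock D i ∧ ∃ j, ¬ FullBlock D j ∧ i ≠ j
  · have hF' : ∃ i, ¬ FullBlock D i ∧ ¬ FullBlock D (i + 1) ∧
        3 ≤ blockCount D i ∧ 3 ≤ blockCount D (i + 1) := by
      obtain ⟨i, hi, j, hj, hij⟩ := hF
      rcases h.eq_add_one_or_eq_add_one (by omega) hi hj hij with ⟨rfl, h1, h2⟩ | ⟨rfl, h1, h2⟩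
      · exact ⟨i, hi, hj, h.three_le_blockCount h1 h2⟩
      · exact ⟨j, hj, hi, h.three_le_blockCount h1 h2⟩
    obtain ⟨i, hi, hj, h3, h3'⟩ := hF'
    refine key i (i + 1) (by simp) fun k => ?_
    by_cases hki : k = i
    · subst hki; simp; omega
    by_cases hkj : k = i + 1
    · subst hkj; simp; omega
    have hk : FullBlock D k := by
      by_contra hk
      have hi2 : i = k + 1 := by
        rcases h.eq_add_one_or_eq_add_one (by omega) hi hk (Ne.symm hki) with h1 | h1
        · exact absurd h1.1 hkj
        · exact h1.1
      have hk2 : k = i + 1 + 1 := by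
        rcases h.eq_add_one_or_eq_add_one (by omega) hj hk (Ne.symm hkj) with h1 | h1
        · exact h1.1
        · exact absurd (add_right_cancel h1.1).symm hki
      have h3 : ((3 : ℕ) : ZMod n) = 0 := by
        push_cast
        linear_combination - hk2 - hi2
      rw [ZMod.natCast_eq_zero_iff] at h3
      exact absurd (Nat.le_of_dvd (by norm_num) h3) (by omega)
    have := four_le_blockCount hk
    omega
  · push Not at hF
    obtain ⟨i, hi⟩ : ∃ i, ∀ k, k ≠ i → FullBlock D k := by
      by_cases hex : ∃ i, ¬ FullBlock D i
      · obtain ⟨i, hi⟩ := hex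
        exact ⟨i, fun k hk => by_contra fun h1 => hk (hF i hi k h1).symm⟩
      · push Not at hex
        exact ⟨0, fun k _ => hex k⟩
    have h2 := h.two_le_blockCount i
    have h1 : ∑ _k : ZMod n, 4 ≤ ∑ k, (blockCount D k + if k = i then 2 else 0) := by
      refine Finset.sum_le_sum fun k _ => ?_
      by_cases hki : k = i
      · subst hki; simp; omega
      · have := four_le_blockCount (hi k hki)
        omega
    simp only [Finset.sum_add_distrib, Finset.sum_ite_eq', Finset.sum_const, Finset.card_univ,
      ZMod.card, Finset.mem_univ, if_true, smul_eq_mul] at h1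
    omega

end ConnectedDominating

end ConnectedDominating

theorem leafCount_le {n : ℕ} [NeZero n] (hn : 3 < n) {T : SimpleGraph (ZMod n × Fin 6)}
    (hTH : T ≤ Hgraph n) (hT : T.Connected) : leafCount T ≤ 2 * n + 2 := by
  have hD : ConnectedDominating (fun v => T.degree v ≠ 1) := by
    constructor
    · intro u hu
      obtain ⟨w, hw, hadj⟩ := hT.exists_adj_nonleaf
        (by simp [Fintype.card_prod, ZMod.card]; omega) (not_not.mp hu)
      exact ⟨w, hw, hTH hadj⟩
    · intro S u w hu hSu hw hSw
      obtain ⟨p, q, h1, h2, h3, h4, h5⟩ := hT.exists_adj_cut_nonleaf S hSu hu hSw hw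
      exact ⟨p, q, h1, h2, h3, h4, hTH h5⟩
  have h1 := hD.le_sum_blockCount hn
  have h0 : ∑ i, blockCount (fun v => T.degree v ≠ 1) i =
      (Finset.univ.filter fun v => ¬ T.degree v = 1).card := by
    rw [Finset.card_filter, Fintype.sum_prod_type]
    simp only [blockCount]
    congr!
  have h2 := Finset.card_filter_add_card_filter_not (s := (Finset.univ : Finset (ZMod n × Fin 6)))
    (fun v => T.degree v = 1)
  rw [Finset.card_univ, Fintype.card_prod, ZMod.card, Fintype.card_fin] at h2
  rw [leafCount, Fintype.card_subtype]
  omega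

section ParentGraph

variable {V : Type*} (p : V → V)

/-- The graph joining every vertex to its image under `p`. -/
def parentGraph : SimpleGraph V := SimpleGraph.fromRel fun u v => v = p u

variable {p}

theorem parentGraph_reachable (u : V) : (parentGraph p).Reachable u (p u) := by
  by_cases h : u = p u
  · rw [← h]
  · exact SimpleGraph.Adj.reachable ⟨h, Or.inl rfl⟩

theorem parentGraph_degree_le [Fintype V] {u : V} (hu : ∀ w, p w ≠ u) :
    (parentGraph p).degree u ≤ 1 := by
  rw [← SimpleGraph.card_neighborFinset_eq_degree, Finset.card_le_one]
  have key (w) (hw : w ∈ (parentGraph p).neighborFinset u) : w = p u := by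
    rw [SimpleGraph.mem_neighborFinset] at hw
    exact hw.2.resolve_right fun h => hu w h.symm
  intro a ha b hb
  rw [key a ha, key b hb]

end ParentGraph

/-- The parent function of a spanning tree of `Hgraph n` rooted at `(1, 4)`. -/
def hParent (n : ℕ) (u : ZMod n × Fin 6) : ZMod n × Fin 6 :=
  if u.1 = 0 then ![(0, 4), (0, 0), (0, 0), (0, 0), (-1, 5), (1, 4)] u.2
  else ![(u.1, 4), (u.1, 0), (u.1, 0), (u.1, 2), if u.1 = 1 then (1, 4) else (u.1 - 1, 5),
    (u.1, 2)] u.2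

theorem parentGraph_hParent_le {n : ℕ} : parentGraph (hParent n) ≤ Hgraph n := by
  have key (u) (hu : u ≠ hParent n u) : (Hgraph n).Adj u (hParent n u) := by
    obtain ⟨i, c⟩ := u
    by_cases h0 : i = 0
    · subst h0
      fin_cases c <;> simp [hParent, Hgraph_adj_iff, blockAdj]
    · by_cases h1 : i = 1
      · subst h1
        fin_cases c <;> simp_all [hParent, Hgraph_adj_iff, blockAdj]
      · fin_cases c <;> simp [hParent, Hgraph_adj_iff, blockAdj, h0, h1]
  rintro u w ⟨hne, rfl | rfl⟩
  · exact key u hne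
  · exact (key w hne.symm).symm

theorem parentGraph_hParent_connected {n : ℕ} [NeZero n] (hn : 1 < n) :
    (parentGraph (hParent n)).Connected := by
  have : Fact (1 < n) := ⟨hn⟩
  have step (u : ZMod n × Fin 6) := parentGraph_reachable (p := hParent n) u
  have hblock (i : ZMod n) (hi : i ≠ 0) (c : Fin 6) :
      (parentGraph (hParent n)).Reachable (i, c) (i, 4) := by
    have h0 := step (i, 0)
    have h1 := step (i, 1)
    have h2 := step (i, 2)
    have h3 := step (i, 3)
    have h5 := step (i, 5)
    simp only [hParent, hi, if_false] at h0 h1 h2 h3 h5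
    have h2' := h2.trans h0
    fin_cases c
    exacts [h0, h1.trans h0, h2', h3.trans h2', .rfl, h5.trans h2']
  have hmain (m : ℕ) : m + 1 < n →
      (parentGraph (hParent n)).Reachable ((m + 1 : ℕ), 4) (1, 4) := by
    induction m with
    | zero => intro; simp
    | succ m ih =>
      intro hm
      have hne (k : ℕ) (hk : k ≠ 0) (hkn : k < n) : (k : ZMod n) ≠ 0 := fun h => by
        rw [ZMod.natCast_eq_zero_iff] at h
        exact absurd (Nat.le_of_dvd (by omega) h) (by omega)
      have h4 := step ((m + 1 + 1 : ℕ), 4)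
      have h1 : ((m + 1 + 1 : ℕ) : ZMod n) ≠ 1 := fun h => hne (m + 1) (by omega) (by omega) <| by
        push_cast at h ⊢
        linear_combination h
      simp only [hParent, hne (m + 1 + 1) (by omega) hm, h1, if_false] at h4
      have h5 : ((m + 1 + 1 : ℕ) : ZMod n) - 1 = (m + 1 : ℕ) := by push_cast; ring
      refine h4.trans ?_
      simp only [Matrix.cons_val, h5]
      exact (hblock _ (hne (m + 1) (by omega) (by omega)) 5).trans (ih (by omega))
  have ha (i : ZMod n) (hi : i ≠ 0) : (parentGraph (hParent n)).Reachable (i, 4) (1, 4) := by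
    have h1 : i.val ≠ 0 := by rwa [Ne, ZMod.val_eq_zero]
    have h2 := hmain (i.val - 1) (by have := i.val_lt; omega)
    rwa [Nat.sub_add_cancel (by omega), ZMod.natCast_zmod_val] at h2
  have hall (u : ZMod n × Fin 6) : (parentGraph (hParent n)).Reachable u (1, 4) := by
    obtain ⟨i, c⟩ := u
    by_cases hi : i = 0
    · subst hi
      have h0 := step (0, 0)
      have h1 := step (0, 1)
      have h2 := step (0, 2)
      have h3 := step (0, 3)
      have h4 := step (0, 4)
      have h5 := step (0, 5)
      simp only [hParent, if_true] at h0 h1 h2 h3 h4 h5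
      have hm : (-1 : ZMod n) ≠ 0 := by simp
      have h4' := (h4.trans (hblock _ hm 5)).trans (ha _ hm)
      have h0' := h0.trans h4'
      fin_cases c
      exacts [h0', h1.trans h0', h2.trans h0', h3.trans h0', h4', h5]
    · exact (hblock i hi c).trans (ha i hi)
  exact (SimpleGraph.connected_iff _).mpr ⟨fun u w => (hall u).trans (hall w).symm, ⟨(0, 0)⟩⟩

theorem hParent_ne {n : ℕ} [Nontrivial (ZMod n)] {i j : ZMod n} {c d : Fin 6}
    (h : c = 1 ∨ c = 3 ∨ i = 0 ∧ (c = 2 ∨ c = 5)) : hParent n (j, d) ≠ (i, c) := by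
  intro he
  by_cases hj : j = 0
  · subst hj
    fin_cases d <;> simp [hParent] at he <;> obtain ⟨rfl, rfl⟩ := he <;> simp at h
  · by_cases hj1 : j = 1
    · subst hj1
      fin_cases d <;> simp [hParent, hj] at he <;> obtain ⟨rfl, rfl⟩ := he <;> simp_all
    · fin_cases d <;> simp [hParent, hj, hj1] at he <;> obtain ⟨rfl, rfl⟩ := he <;>
        simp_all [sub_eq_zero]

theorem exists_isTree_le_leafCount {n : ℕ} [NeZero n] (hn : 1 < n) :
    ∃ T ≤ Hgraph n, T.IsTree ∧ 2 * n + 2 ≤ leafCount T := by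
  have : Fact (1 < n) := ⟨hn⟩
  obtain ⟨T, hle, hT⟩ := (parentGraph_hParent_connected hn).exists_isTree_le
  refine ⟨T, hle.trans parentGraph_hParent_le, hT, ?_⟩
  have hleaf (i : ZMod n) (c : Fin 6) (h : c = 1 ∨ c = 3 ∨ i = 0 ∧ (c = 2 ∨ c = 5)) :
      T.degree (i, c) = 1 := by
    have h1 := parentGraph_degree_le (p := hParent n) (u := (i, c)) fun w => hParent_ne h
    have h2 := SimpleGraph.degree_le_of_le (v := (i, c)) hle
    have h3 := hT.1.preconnected.degree_pos_of_nontrivial (i, c)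
    omega
  let s : Finset (ZMod n × Fin 6) := Finset.univ ×ˢ {1, 3} ∪ {((0 : ZMod n), (2 : Fin 6)), (0, 5)}
  have hs : s.card = 2 * n + 2 := by
    rw [Finset.card_union_of_disjoint]
    · simp [ZMod.card, mul_comm]
    · simp
  rw [leafCount, Fintype.card_subtype, ← hs]
  refine Finset.card_le_card fun u hu => ?_
  obtain ⟨i, c⟩ := u
  simp only [Finset.mem_filter, Finset.mem_univ, true_and]
  apply hleaf
  simp [s] at hu
  tauto

/-- For every `n ≥ 21`, `H_n` is a connected graph all of whose vertices have degree
3 or 4, the maximum number of leaves of a spanning tree of `H_n` equals `2n + 2`, and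
`2n + 2` is strictly smaller than `∑_{x} (d(x) - 2)/(d(x) + 1) = 21n/10`.  In
particular `H_n` disproves the strong Linial conjecture for graphs with all degrees
equal to 3 or 4. -/
theorem Hgraph_disproves_strong_Linial (n : ℕ) [NeZero n] (hn : 21 ≤ n) :
    (Hgraph n).Connected ∧
    (∀ v : ZMod n × Fin 6, (Hgraph n).degree v = 3 ∨ (Hgraph n).degree v = 4) ∧
    (∃ T ≤ Hgraph n, T.IsTree ∧ leafCount T = 2 * n + 2) ∧
    (∀ T ≤ Hgraph n, T.IsTree → leafCount T ≤ 2 * n + 2) ∧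
    (∑ v : ZMod n × Fin 6,
        (((Hgraph n).degree v : ℚ) - 2) / (((Hgraph n).degree v : ℚ) + 1)
      = 21 * n / 10) ∧
    ((2 * n + 2 : ℚ) < 21 * n / 10) := by
  have h1n : 1 < n := by omega
  have hub (T : SimpleGraph (ZMod n × Fin 6)) (hle : T ≤ Hgraph n) (hT : T.IsTree) :=
    leafCount_le (by omega) hle hT.1
  refine ⟨(parentGraph_hParent_connected h1n).mono parentGraph_hParent_le, ?_, ?_, hub,
    sum_Hgraph_degree, ?_⟩
  · rintro ⟨i, c⟩
    rw [Hgraph_degree]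
    split_ifs <;> simp
  · obtain ⟨T, hle, hT, hleaf⟩ := exists_isTree_le_leafCount h1n
    exact ⟨T, hle, hT, le_antisymm (hub T hle hT) hleaf⟩
  · have h : (21 : ℚ) ≤ n := by exact_mod_cast hn
    linarith
end

section
/- For every integer n ≥ 2 and every spanning tree T of the graph H_n, the set of leaves of T is not a cutset of H_n; that is, deleting from H_n all vertices that are leaves of T leaves a connected graph. -/
open scoped Classical

/-- Deleting all leaves of a finite tree with at least three vertices leaves a connected graph. -/
theorem SimpleGraph.IsTree.connected_induce_degree_ne_one {V : Type*} [Fintype V]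
    {T : SimpleGraph V} (hT : T.IsTree) (hcard : 2 < Fintype.card V) :
    (T.induce {v | ¬ T.degree v = 1}).Connected := by
  have hpre : (T.induce {v | ¬ T.degree v = 1}).Preconnected := by
    refine hT.connected.preconnected.induce_of_degree_eq_one fun v hv => ?_
    have hdeg : T.degree v = 1 := not_not.mp hv
    obtain ⟨w, -, huniq⟩ := T.degree_eq_one_iff_existsUnique_adj.mp hdeg
    intro a ha b hb
    rw [huniq a ha, huniq b hb]
  have hne : ∃ v, ¬ T.degree v = 1 := by
    by_contra! hleaf
    have hsum := T.sum_degrees_eq_twice_card_edges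
    have hedges := hT.card_edgeFinset
    simp only [hleaf, Finset.sum_const, Finset.card_univ, smul_eq_mul, mul_one] at hsum
    omega
  obtain ⟨v, hv⟩ := hne
  exact { preconnected := hpre, nonempty := ⟨⟨v, hv⟩⟩ }

/-- For every `n ≥ 2` and every spanning tree `T` of `H_n`, the set of leaves of `T`
is not a cutset of `H_n`: deleting all leaves of `T` from `H_n` leaves a connected
graph. -/
theorem Hgraph_leaves_not_cutset (n : ℕ) [NeZero n] (hn : 2 ≤ n)
    (T : SimpleGraph (ZMod n × Fin 6)) (hT : T ≤ Hgraph n) (htree : T.IsTree) :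
    ((Hgraph n).induce {v : ZMod n × Fin 6 | ¬ T.degree v = 1}).Connected := by
  have hcard : 2 < Fintype.card (ZMod n × Fin 6) := by
    rw [Fintype.card_prod, ZMod.card, Fintype.card_fin]
    omega
  have hconn := htree.connected_induce_degree_ne_one hcard
  exact SimpleGraph.Connected.mono (G := T.induce _) (fun u v huv => hT huv) (by convert hconn)
end
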